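/- arXiv:2209.14177 — 3 statements merged into one kernel-verified Lean document; each statement's English description precedes it below -/
import Mathlib

section
/- For all integers r ≥ 3 and t with 2 ≤ t ≤ r−1, the liminf over n of n^{-t} f^{(r)}(n; 4r−3t, 4) is at least 1 / (t! · C(r,t)), where C(r,t) denotes the binomial coefficient r choose t. -/
open Finset Filter

/-- An `r`-graph is `(s,k)`-free if it has no `k` distinct edges spanning at most `s` vertices. -/
def IsFree {V : Type*} [DecidableEq V] (G : Finset (Finset V)) (s k : ℕ) : Prop :=
  ¬ ∃ S ⊆ G, S.card = k ∧ (S.sup id).card ≤ s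

/-- `exNum r n s k` is the maximum number of edges of an `(s,k)`-free `r`-uniform
hypergraph on `n` vertices, i.e. `f^{(r)}(n; s, k)`. -/
noncomputable def exNum (r n s k : ℕ) : ℕ :=
  sSup {m : ℕ | ∃ G : Finset (Finset (Fin n)),
    (∀ e ∈ G, e.card = r) ∧ IsFree G s k ∧ G.card = m}

set_option linter.unusedSectionVars false

namespace Bernoulli

variable {ι : Type*} [Fintype ι] [DecidableEq ι]

/-- The weight of `ω` under the product of Bernoulli distributions with parameters `p`. -/
noncomputable def wt (p : ι → ℝ) (ω : ι → Bool) : ℝ := ∏ x, if ω x then p x else 1 - p x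

/-- Expectation under the product of Bernoulli distributions with parameters `p`. -/
noncomputable def ex (p : ι → ℝ) (f : (ι → Bool) → ℝ) : ℝ := ∑ ω, wt p ω * f ω

open Classical in
/-- Probability under the product of Bernoulli distributions with parameters `p`. -/
noncomputable def pr (p : ι → ℝ) (s : (ι → Bool) → Prop) : ℝ :=
  ex p (fun ω => if s ω then 1 else 0)

lemma sum_wt (p : ι → ℝ) : ∑ ω, wt p ω = 1 := by
  unfold wt
  have := Finset.prod_univ_sum (fun _ : ι => (univ : Finset Bool))
    (fun x b => if b then p x else 1 - p x)
  rw [Fintype.piFinset_univ] at this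
  simpa using this.symm

lemma wt_nonneg {p : ι → ℝ} (h0 : ∀ x, 0 ≤ p x) (h1 : ∀ x, p x ≤ 1) (ω : ι → Bool) :
    0 ≤ wt p ω := by
  refine prod_nonneg fun x _ => ?_
  split_ifs
  · exact h0 x
  · linarith [h1 x]

lemma ex_const (p : ι → ℝ) (c : ℝ) : ex p (fun _ => c) = c := by
  simp [ex, ← sum_mul, sum_wt]

lemma ex_add (p : ι → ℝ) (f g : (ι → Bool) → ℝ) :
    ex p (fun ω => f ω + g ω) = ex p f + ex p g := by
  simp [ex, mul_add, sum_add_distrib]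

lemma ex_sub (p : ι → ℝ) (f g : (ι → Bool) → ℝ) :
    ex p (fun ω => f ω - g ω) = ex p f - ex p g := by
  simp [ex, mul_sub, sum_sub_distrib]

lemma ex_mul_left (p : ι → ℝ) (c : ℝ) (f : (ι → Bool) → ℝ) :
    ex p (fun ω => c * f ω) = c * ex p f := by
  simp only [ex, mul_sum]
  exact sum_congr rfl fun _ _ => by ring

lemma ex_sum (p : ι → ℝ) {κ : Type*} (s : Finset κ) (f : κ → (ι → Bool) → ℝ) :
    ex p (fun ω => ∑ k ∈ s, f k ω) = ∑ k ∈ s, ex p (f k) := by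
  simp only [ex, mul_sum]
  rw [sum_comm]

lemma ex_mono {p : ι → ℝ} (h0 : ∀ x, 0 ≤ p x) (h1 : ∀ x, p x ≤ 1) {f g : (ι → Bool) → ℝ}
    (h : ∀ ω, f ω ≤ g ω) : ex p f ≤ ex p g :=
  sum_le_sum fun ω _ => mul_le_mul_of_nonneg_left (h ω) (wt_nonneg h0 h1 ω)

lemma exists_ex_le {p : ι → ℝ} (h0 : ∀ x, 0 ≤ p x) (h1 : ∀ x, p x ≤ 1) (f : (ι → Bool) → ℝ) :
    ∃ ω, ex p f ≤ f ω := by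
  by_contra! h
  have h2 : ex p f < ex p f := by
    calc ex p f = ∑ ω, wt p ω * f ω := rfl
      _ < ∑ ω, wt p ω * ex p f := by
        obtain ⟨ω, hω, hpos⟩ : ∃ ω ∈ (univ : Finset (ι → Bool)), 0 < wt p ω := by
          by_contra! h3
          have := sum_wt p
          have h4 : ∑ ω, wt p ω ≤ 0 := sum_nonpos h3
          linarith
        refine sum_lt_sum (fun ω _ => mul_le_mul_of_nonneg_left (h ω).le (wt_nonneg h0 h1 ω))
          ⟨ω, hω, mul_lt_mul_of_pos_left (h ω) hpos⟩
      _ = ex p f := by rw [← sum_mul, sum_wt, one_mul]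
  exact lt_irrefl _ h2

/-- Exchange the coordinates in `A` between two independent samples. -/
lemma sum_swap {p q : ι → ℝ} (A : Set ι) [DecidablePred (· ∈ A)] (hpq : ∀ x ∈ A, p x = q x)
    (F : (ι → Bool) → (ι → Bool) → ℝ) :
    ∑ ω, ∑ ω', wt p ω * wt q ω' * F ω ω' =
      ∑ ω, ∑ ω', wt p ω * wt q ω' * F (A.piecewise ω' ω) (A.piecewise ω ω') := by
  rw [← Fintype.sum_prod_type', ← Fintype.sum_prod_type']
  have hinv : Function.Involutive (fun z : (ι → Bool) × (ι → Bool) =>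
      (A.piecewise z.2 z.1, A.piecewise z.1 z.2)) := by
    intro z
    ext x <;> by_cases hx : x ∈ A <;> simp [hx]
  refine (Fintype.sum_equiv hinv.toPerm _ _ ?_).symm
  rintro ⟨ω, ω'⟩
  simp only [Function.Involutive.coe_toPerm]
  congr 1
  unfold wt
  rw [← prod_mul_distrib, ← prod_mul_distrib]
  refine prod_congr rfl fun x _ => ?_
  by_cases hx : x ∈ A
  · simp [hx, hpq x hx, mul_comm]
  · simp [hx]

lemma ex_congr {p q : ι → ℝ} {A : Set ι} (hpq : ∀ x ∈ A, p x = q x) {f : (ι → Bool) → ℝ}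
    (hf : DependsOn f A) : ex p f = ex q f := by
  classical
  have h := sum_swap A hpq (fun ω _ => f ω)
  have h1 : ∀ ω ω', f (A.piecewise ω' ω) = f ω' := fun ω ω' => hf fun x hx => by simp [hx]
  simp only [h1] at h
  have h2 : ∑ ω, ∑ ω', wt p ω * wt q ω' * f ω = ex p f := by
    refine sum_congr rfl fun ω _ => ?_
    rw [← sum_mul, ← mul_sum, sum_wt, mul_one]
  have h3 : ∑ ω, ∑ ω', wt p ω * wt q ω' * f ω' = ex q f := by
    simp only [mul_assoc, ← mul_sum]
    rw [← sum_mul, sum_wt, one_mul]; rfl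
  rw [← h2, h, h3]

lemma ex_mul (p : ι → ℝ) {A B : Set ι} (hAB : Disjoint A B) {f g : (ι → Bool) → ℝ}
    (hf : DependsOn f A) (hg : DependsOn g B) :
    ex p (fun ω => f ω * g ω) = ex p f * ex p g := by
  classical
  have h := sum_swap (p := p) (q := p) A (fun _ _ => rfl) (fun ω ω' => f ω * g ω')
  have h1 : ∀ ω ω', f (A.piecewise ω' ω) = f ω' := fun ω ω' => hf fun x hx => by simp [hx]
  have h2 : ∀ ω ω', g (A.piecewise ω ω') = g ω' := fun ω ω' => hg fun x hx => by
    have : x ∉ A := fun h => Set.disjoint_left.1 hAB h hx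
    simp [this]
  simp only [h1, h2] at h
  have h3 : ∑ ω, ∑ ω', wt p ω * wt p ω' * (f ω * g ω') = ex p f * ex p g := by
    simp only [ex, sum_mul_sum]
    exact sum_congr rfl fun _ _ => sum_congr rfl fun _ _ => by ring
  have h4 : ∑ ω, ∑ ω', wt p ω * wt p ω' * (f ω' * g ω') = ex p (fun ω => f ω * g ω) := by
    simp only [mul_assoc, ← mul_sum]
    rw [← sum_mul, sum_wt, one_mul]; rfl
  rw [← h3, h, h4]

lemma _root_.DependsOn.finset_prod {κ : Type*} (s : Finset κ) {R : κ → Set ι}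
    {f : κ → (ι → Bool) → ℝ} (hf : ∀ k ∈ s, DependsOn (f k) (R k)) :
    DependsOn (fun ω => ∏ k ∈ s, f k ω) (⋃ k ∈ s, R k) := by
  intro x y h
  refine prod_congr rfl fun k hk => hf k hk fun i hi => h i ?_
  exact Set.mem_biUnion hk hi

lemma ex_prod (p : ι → ℝ) {κ : Type*} (s : Finset κ) {R : κ → Set ι}
    {f : κ → (ι → Bool) → ℝ} (hf : ∀ k ∈ s, DependsOn (f k) (R k))
    (hR : ∀ k ∈ s, ∀ l ∈ s, k ≠ l → Disjoint (R k) (R l)) :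
    ex p (fun ω => ∏ k ∈ s, f k ω) = ∏ k ∈ s, ex p (f k) := by
  classical
  induction s using Finset.induction_on with
  | empty => simp [ex_const]
  | insert a s ha ih =>
    simp only [prod_insert ha]
    rw [ex_mul p (A := R a) (B := ⋃ k ∈ s, R k) _ (hf a (mem_insert_self a s))
      (DependsOn.finset_prod s fun k hk => hf k (mem_insert_of_mem hk)), ih]
    · exact fun k hk => hf k (mem_insert_of_mem hk)
    · exact fun k hk l hl => hR k (mem_insert_of_mem hk) l (mem_insert_of_mem hl)
    · rw [Set.disjoint_iUnion₂_right]
      intro k hk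
      exact hR a (mem_insert_self a s) k (mem_insert_of_mem hk) (by rintro rfl; exact ha hk)

lemma pr_nonneg {p : ι → ℝ} (h0 : ∀ x, 0 ≤ p x) (h1 : ∀ x, p x ≤ 1) (s : (ι → Bool) → Prop) :
    0 ≤ pr p s := by
  classical
  rw [← ex_const p 0]
  exact ex_mono h0 h1 fun ω => by split_ifs <;> norm_num

lemma pr_mono {p : ι → ℝ} (h0 : ∀ x, 0 ≤ p x) (h1 : ∀ x, p x ≤ 1) {s t : (ι → Bool) → Prop}
    (h : ∀ ω, s ω → t ω) : pr p s ≤ pr p t := by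
  classical
  refine ex_mono h0 h1 fun ω => ?_
  by_cases hs : s ω
  · simp [hs, h ω hs]
  · simp only [hs, if_false]; split_ifs <;> norm_num

lemma pr_not (p : ι → ℝ) (s : (ι → Bool) → Prop) : pr p (fun ω => ¬ s ω) = 1 - pr p s := by
  classical
  rw [← ex_const p 1, pr, pr, ← ex_sub]
  congr 1; ext ω
  by_cases h : s ω <;> simp [h]

lemma pr_or_le {p : ι → ℝ} (h0 : ∀ x, 0 ≤ p x) (h1 : ∀ x, p x ≤ 1) (s t : (ι → Bool) → Prop) :
    pr p (fun ω => s ω ∨ t ω) ≤ pr p s + pr p t := by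
  classical
  rw [pr, pr, pr, ← ex_add]
  refine ex_mono h0 h1 fun ω => ?_
  by_cases hs : s ω <;> by_cases ht : t ω <;> simp [hs, ht]

lemma pr_exists_le {p : ι → ℝ} (h0 : ∀ x, 0 ≤ p x) (h1 : ∀ x, p x ≤ 1) {κ : Type*}
    (S : Finset κ) (s : κ → (ι → Bool) → Prop) :
    pr p (fun ω => ∃ k ∈ S, s k ω) ≤ ∑ k ∈ S, pr p (s k) := by
  classical
  simp only [pr]
  rw [← ex_sum]
  refine ex_mono h0 h1 fun ω => ?_
  split_ifs with h
  · obtain ⟨k, hk, hs⟩ := h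
    have := single_le_sum (f := fun k => if s k ω then (1 : ℝ) else 0) (s := S)
      (fun k _ => by split_ifs <;> norm_num) hk
    simpa [hs] using this
  · exact sum_nonneg fun k _ => by split_ifs <;> norm_num

lemma pr_and (p : ι → ℝ) {A B : Set ι} (hAB : Disjoint A B) {s t : (ι → Bool) → Prop}
    (hs : DependsOn s A) (ht : DependsOn t B) :
    pr p (fun ω => s ω ∧ t ω) = pr p s * pr p t := by
  classical
  rw [pr, pr, pr, ← ex_mul p hAB (fun x y h => by rw [hs h]) (fun x y h => by rw [ht h])]
  congr 1; ext ω
  by_cases h : s ω <;> by_cases h' : t ω <;> simp [h, h']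

lemma pr_forall (p : ι → ℝ) {κ : Type*} (S : Finset κ) {R : κ → Set ι}
    {s : κ → (ι → Bool) → Prop} (hs : ∀ k ∈ S, DependsOn (s k) (R k))
    (hR : ∀ k ∈ S, ∀ l ∈ S, k ≠ l → Disjoint (R k) (R l)) :
    pr p (fun ω => ∀ k ∈ S, s k ω) = ∏ k ∈ S, pr p (s k) := by
  classical
  simp only [pr]
  rw [← ex_prod p S (fun k hk x y h => by rw [hs k hk h]) hR]
  congr 1; ext ω
  split_ifs with h
  · exact (prod_eq_one fun k hk => if_pos (h k hk)).symm
  · push Not at h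
    obtain ⟨k, hk, hk'⟩ := h
    exact (prod_eq_zero hk (if_neg hk')).symm

lemma pr_coord (p : ι → ℝ) (x : ι) : pr p (fun ω => ω x = true) = p x := by
  classical
  have h := Finset.prod_univ_sum (fun _ : ι => (univ : Finset Bool))
    (fun y b => (if b then p y else 1 - p y) * (if y = x then (if b then 1 else 0) else 1))
  have h1 : ∀ y, ∑ b : Bool, ((if b then p y else 1 - p y) *
      (if y = x then (if b then (1:ℝ) else 0) else 1)) = if y = x then p y else 1 := by
    intro y; by_cases hy : y = x <;> simp [hy]
  simp only [h1] at h
  simp only [prod_ite_eq', mem_univ, if_true, Fintype.piFinset_univ] at h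
  rw [h, pr, ex]
  refine sum_congr rfl fun ω _ => ?_
  rw [prod_mul_distrib]
  congr 1
  rw [prod_ite_eq']; simp

lemma pr_forall_coord (p : ι → ℝ) (S : Finset ι) :
    pr p (fun ω => ∀ x ∈ S, ω x = true) = ∏ x ∈ S, p x := by
  rw [pr_forall p S (R := fun x => {x})]
  · exact prod_congr rfl fun x _ => pr_coord p x
  · intro k _ x y h
    simp [h k rfl]
  · intro k _ l _ h; simpa using h

end Bernoulli

namespace Nibble

variable {E : Type*} {T : ℕ}

/-- `e` carries the label `i`. -/
def Lab (ω : E × Fin T → Bool) (i : ℕ) (e : E) : Prop := ∃ h : i < T, ω (e, ⟨i, h⟩) = true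

/-- The smallest label of `e` is `i`. -/
def FirstAt (ω : E × Fin T → Bool) (i : ℕ) (e : E) : Prop :=
  Lab ω i e ∧ ∀ j < i, ¬ Lab ω j e

/-- The elements accepted before round `i`: in round `i` those elements with first label `i` are
accepted that do not complete a block together with elements accepted earlier or processed in the
same round. -/
def acc (𝓑 : Finset (Finset E)) (ω : E × Fin T → Bool) : ℕ → Set E
  | 0 => ∅
  | i + 1 => acc 𝓑 ω i ∪ {e | FirstAt ω i e ∧
      ∀ B ∈ 𝓑, e ∈ B → ∃ f ∈ B, f ≠ e ∧ f ∉ acc 𝓑 ω i ∧ ¬ FirstAt ω i f}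

/-- `e` completes no block together with elements accepted before round `i`. -/
def Avail (𝓑 : Finset (Finset E)) (ω : E × Fin T → Bool) (i : ℕ) (e : E) : Prop :=
  ∀ B ∈ 𝓑, e ∈ B → ∃ f ∈ B, f ≠ e ∧ f ∉ acc 𝓑 ω i

/-- `e` is accepted in round `i`. -/
def NewAt (𝓑 : Finset (Finset E)) (ω : E × Fin T → Bool) (i : ℕ) (e : E) : Prop :=
  FirstAt ω i e ∧ ∀ B ∈ 𝓑, e ∈ B → ∃ f ∈ B, f ≠ e ∧ f ∉ acc 𝓑 ω i ∧ ¬ FirstAt ω i f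

/-- Some block through `e` consists, apart from `e`, of elements that are accepted before round `i`
or labelled `i`, at least one of them being labelled `i`. -/
def Clash (𝓑 : Finset (Finset E)) (ω : E × Fin T → Bool) (i : ℕ) (e : E) : Prop :=
  ∃ B ∈ 𝓑, e ∈ B ∧ ∃ f ∈ B, f ≠ e ∧ Lab ω i f ∧
    ∀ f' ∈ B, f' ≠ e → f' ≠ f → f' ∈ acc 𝓑 ω i ∨ Lab ω i f'

/-- Erase all labels of `e`. -/
def rm [DecidableEq E] (e : E) (ω : E × Fin T → Bool) : E × Fin T → Bool :=
  fun x => if x.1 = e then false else ω x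

/-- The elements whose labels can influence, within `k` rounds, whether `f` is accepted, when `e`
has no labels. -/
def reach (𝓑 : Finset (Finset E)) (e : E) : ℕ → E → Set E
  | 0, f => {f}
  | k + 1, f => reach 𝓑 e k f ∪ {x | ∃ B ∈ 𝓑, e ∉ B ∧ f ∈ B ∧ ∃ f₁ ∈ B, x ∈ reach 𝓑 e k f₁}

section Rounds

variable {𝓑 : Finset (Finset E)} {ω ω' : E × Fin T → Bool} {i j k : ℕ} {e f : E}

lemma mem_acc_succ : e ∈ acc 𝓑 ω (i + 1) ↔ e ∈ acc 𝓑 ω i ∨ NewAt 𝓑 ω i e := Iff.rfl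

lemma acc_mono (𝓑 : Finset (Finset E)) (ω : E × Fin T → Bool) : Monotone (acc 𝓑 ω) :=
  monotone_nat_of_le_succ fun _ _ h => Or.inl h

lemma not_block_subset_acc {B : Finset E} (hB : B ∈ 𝓑) (hne : B.Nonempty) :
    ¬ ∀ f ∈ B, f ∈ acc 𝓑 ω i := by
  induction i with
  | zero =>
    obtain ⟨f, hf⟩ := hne
    exact fun h => h f hf
  | succ i ih =>
    intro h
    push Not at ih
    obtain ⟨e, he, hei⟩ := ih
    rcases h e he with h1 | ⟨-, h1⟩
    · exact hei h1
    · obtain ⟨f, hf, -, hfi, hff⟩ := h1 B hB he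
      rcases h f hf with h2 | h2
      · exact hfi h2
      · exact hff h2.1

lemma NewAt.mem_acc (h : NewAt 𝓑 ω i e) (hij : i < j) : e ∈ acc 𝓑 ω j :=
  acc_mono 𝓑 ω hij (Or.inr h)

lemma FirstAt.unique (h : FirstAt ω i e) (h' : FirstAt ω j e) : i = j := by
  rcases lt_trichotomy i j with hij | hij | hij
  · exact absurd h.1 (h'.2 i hij)
  · exact hij
  · exact absurd h'.1 (h.2 j hij)

lemma mem_reach_self : f ∈ reach 𝓑 e k f := by
  induction k with
  | zero => exact rfl
  | succ k ih => exact Or.inl ih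

lemma reach_mono (𝓑 : Finset (Finset E)) (e f : E) : Monotone (fun k => reach 𝓑 e k f) :=
  monotone_nat_of_le_succ fun _ _ h => Or.inl h

variable [DecidableEq E]

lemma not_lab_rm_self : ¬ Lab (rm e ω) i e := by
  rintro ⟨h, h'⟩
  simp [rm] at h'

lemma not_mem_acc_rm_self : e ∉ acc 𝓑 (rm e ω) i := by
  induction i with
  | zero => exact fun h => h
  | succ i ih =>
    rintro (h | h)
    · exact ih h
    · exact not_lab_rm_self h.1.1

lemma lab_rm (h : f ≠ e) : Lab (rm e ω) i f ↔ Lab ω i f := by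
  simp [Lab, rm, h]

lemma firstAt_rm (h : f ≠ e) : FirstAt (rm e ω) i f ↔ FirstAt ω i f := by
  simp [FirstAt, lab_rm h]

lemma acc_rm_of_not_lab (h : ∀ j < i, ¬ Lab ω j e) : acc 𝓑 (rm e ω) i = acc 𝓑 ω i := by
  induction i with
  | zero => rfl
  | succ i ih =>
    have ih := ih fun j hj => h j (by omega)
    have hF : ∀ f, FirstAt (rm e ω) i f ↔ FirstAt ω i f := by
      intro f
      by_cases hf : f = e
      · subst hf
        exact ⟨fun h1 => absurd h1.1 not_lab_rm_self, fun h1 => absurd h1.1 (h i (by omega))⟩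
      · exact firstAt_rm hf
    simp only [acc, ih, hF]

lemma rm_eq_of_not_lab (h : ∀ j, ¬ Lab ω j e) : rm e ω = ω := by
  ext ⟨f, i⟩
  by_cases hf : f = e
  · subst hf
    have := h i
    simp only [Lab, not_exists] at this
    have := this i.2
    simp only [Fin.eta, Bool.not_eq_true] at this
    simp [rm, this]
  · simp [rm, hf]

lemma NewAt.avail_rm (h : NewAt 𝓑 ω i e) : Avail 𝓑 (rm e ω) i e := by
  intro B hB heB
  obtain ⟨f, hf, hfe, hfi, -⟩ := h.2 B hB heB
  exact ⟨f, hf, hfe, by rwa [acc_rm_of_not_lab h.1.2]⟩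

lemma newAt_or_clash (h : FirstAt ω i e) (ha : Avail 𝓑 (rm e ω) i e) :
    NewAt 𝓑 ω i e ∨ Clash 𝓑 (rm e ω) i e := by
  by_cases hn : NewAt 𝓑 ω i e
  · exact Or.inl hn
  right
  simp only [NewAt, h, true_and] at hn
  push Not at hn
  obtain ⟨B, hB, heB, hn⟩ := hn
  obtain ⟨f, hf, hfe, hfi⟩ := ha B hB heB
  refine ⟨B, hB, heB, f, hf, hfe, ?_, fun f' hf' hfe' _ => ?_⟩
  · rw [lab_rm hfe]
    exact (hn f hf hfe (by rwa [← acc_rm_of_not_lab h.2])).1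
  · rw [lab_rm hfe', acc_rm_of_not_lab h.2]
    by_cases h1 : f' ∈ acc 𝓑 ω i
    · exact Or.inl h1
    · exact Or.inr (hn f' hf' hfe' h1).1

lemma dependsOn_lab (i : ℕ) (f : E) :
    DependsOn (fun ω : E × Fin T → Bool => Lab ω i f) {x | x.1 = f ∧ x.2 = i} := by
  intro ω ω' h
  refine propext (exists_congr fun hi => ?_)
  rw [h (f, ⟨i, hi⟩) ⟨rfl, rfl⟩]

lemma dependsOn_firstAt (i : ℕ) (f : E) :
    DependsOn (fun ω : E × Fin T → Bool => FirstAt ω i f) {x | x.1 = f ∧ x.2 ≤ i} := by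
  intro ω ω' h
  have h1 : ∀ j ≤ i, (Lab ω j f ↔ Lab ω' j f) := fun j hj =>
    iff_of_eq (dependsOn_lab j f fun x hx => h x ⟨hx.1, hx.2.trans_le hj⟩)
  refine propext (and_congr (h1 i le_rfl) ?_)
  exact forall₂_congr fun j hj => not_congr (h1 j hj.le)

lemma dependsOn_acc (i : ℕ) :
    DependsOn (fun ω : E × Fin T → Bool => acc 𝓑 ω i) {x | (x.2 : ℕ) < i} := by
  induction i with
  | zero => exact fun _ _ _ => rfl
  | succ i ih =>
    intro ω ω' h
    have h1 : acc 𝓑 ω i = acc 𝓑 ω' i := ih fun x hx => h x (Nat.lt_succ_of_lt hx)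
    have h2 : ∀ f, FirstAt ω i f = FirstAt ω' i f := fun f =>
      dependsOn_firstAt i f fun x hx => h x (Nat.lt_succ_of_le hx.2)
    simp only [acc, h1, h2]

lemma rm_congr (h : ∀ x : E × Fin T, x.1 ≠ e → ω x = ω' x) : rm e ω = rm e ω' := by
  ext x
  by_cases hx : x.1 = e
  · simp [rm, hx]
  · simp [rm, hx, h x hx]

lemma dependsOn_rm {α : Type*} (F : (E × Fin T → Bool) → α) (e : E) :
    DependsOn (fun ω => F (rm e ω)) {x | x.1 ≠ e} := fun ω ω' h => by
  simp only [rm_congr (ω := ω) (ω' := ω') h]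

lemma dependsOn_avail_rm (i : ℕ) (e : E) :
    DependsOn (fun ω : E × Fin T → Bool => Avail 𝓑 (rm e ω) i e) {x | (x.2 : ℕ) < i} := by
  intro ω ω' h
  have : acc 𝓑 (rm e ω) i = acc 𝓑 (rm e ω') i := dependsOn_acc i fun x hx => by
    simp only [rm, h x hx]
  simp only [Avail, this]

lemma dependsOn_mem_acc_rm (e : E) (i : ℕ) (f : E) :
    DependsOn (fun ω : E × Fin T → Bool => f ∈ acc 𝓑 (rm e ω) i) {x | x.1 ∈ reach 𝓑 e i f} := by
  induction i generalizing f with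
  | zero => exact fun _ _ _ => rfl
  | succ i ih =>
    intro ω ω' h
    by_cases hfe : f = e
    · subst hfe
      simp [not_mem_acc_rm_self]
    have h1 : f ∈ acc 𝓑 (rm e ω) i ↔ f ∈ acc 𝓑 (rm e ω') i :=
      iff_of_eq (ih f fun x hx => h x (Or.inl hx))
    have hF : ∀ g, (∀ x : E × Fin T, x.1 = g → ω x = ω' x) →
        (FirstAt (rm e ω) i g ↔ FirstAt (rm e ω') i g) := fun g hg =>
      iff_of_eq (dependsOn_firstAt i g fun x hx => by simp only [rm, hg x hx.1])
    have h2 : FirstAt (rm e ω) i f ↔ FirstAt (rm e ω') i f := hF f fun x hx =>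
      h x (Or.inl (hx ▸ mem_reach_self))
    refine propext (or_congr h1 (and_congr_right' ?_ |>.trans (and_congr_left' h2)))
    refine forall₂_congr fun B hB => forall_congr' fun hfB => ?_
    by_cases heB : e ∈ B
    · have h3 : ∀ ω : E × Fin T → Bool,
          ∃ g ∈ B, g ≠ f ∧ g ∉ acc 𝓑 (rm e ω) i ∧ ¬ FirstAt (rm e ω) i g := fun ω =>
        ⟨e, heB, Ne.symm hfe, not_mem_acc_rm_self, fun h => not_lab_rm_self h.1⟩
      exact iff_of_true (h3 ω) (h3 ω')
    · refine exists_congr fun g => and_congr_right fun hg => and_congr_right fun hgf => ?_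
      have h3 : ∀ x : E × Fin T, x.1 ∈ reach 𝓑 e i g → ω x = ω' x := fun x hx =>
        h x (Or.inr ⟨B, hB, heB, hfB, g, hg, hx⟩)
      exact and_congr (not_congr (iff_of_eq (ih g h3)))
        (not_congr (hF g fun x hx => h3 x (hx ▸ mem_reach_self)))

end Rounds

end Nibble

namespace Nibble
open Bernoulli

variable {E β : Type*} {T : ℕ} [Fintype E] [DecidableEq E] {𝓑 : Finset (Finset E)}

/-- A system of blocks of sizes two to four in which the blocks of size two come from the stars of
a bounded-degree hypergraph `V`, the larger blocks through an element have bounded total weight, and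
different blocks or stars through an element do not interact within `T` rounds. -/
structure LocallySparse (𝓑 : Finset (Finset E)) (V : E → Finset β) (T C : ℕ) (D K : ℝ) :
    Prop where
  two_le_card : ∀ B ∈ 𝓑, 2 ≤ B.card
  card_le_four : ∀ B ∈ 𝓑, B.card ≤ 4
  card_V : ∀ e, (V e).card ≤ C
  degree : ∀ e, ∀ S ∈ V e, ∀ s : Finset E, (∀ f ∈ s, S ∈ V f) → (s.card : ℝ) ≤ D
  pair : ∀ e f, e ≠ f → {e, f} ∈ 𝓑 → ∃ S ∈ V e, S ∈ V f
  weight : ∀ e, ∑ B ∈ 𝓑 with e ∈ B, (D⁻¹) ^ (B.card - 1) ≤ K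
  disjoint_star : ∀ e, ∀ S ∈ V e, ∀ S' ∈ V e, S ≠ S' → ∀ f ≠ e, ∀ f' ≠ e, S ∈ V f → S' ∈ V f' →
    Disjoint (reach 𝓑 e T f) (reach 𝓑 e T f')
  disjoint_star_block : ∀ e, ∀ S ∈ V e, ∀ B ∈ 𝓑, e ∈ B → 3 ≤ B.card → ∀ f ≠ e, S ∈ V f →
    ∀ f' ∈ B, f' ≠ e → Disjoint (reach 𝓑 e T f) (reach 𝓑 e T f')
  disjoint_block : ∀ e, ∀ B ∈ 𝓑, ∀ B' ∈ 𝓑, e ∈ B → e ∈ B' → 3 ≤ B.card → 3 ≤ B'.card → B ≠ B' →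
    ∀ f ∈ B, f ≠ e → ∀ f' ∈ B', f' ≠ e → Disjoint (reach 𝓑 e T f) (reach 𝓑 e T f')
  disjoint_mem : ∀ B ∈ 𝓑, ∀ e ∈ B, ∀ f ∈ B, ∀ f' ∈ B, f ≠ e → f' ≠ e → f ≠ f' →
    Disjoint (reach 𝓑 e T f) (reach 𝓑 e T f')

variable {p : E × Fin T → ℝ}

lemma pr_lab (i : Fin T) (e : E) : pr p (fun ω => Lab ω i e) = p (e, i) := by
  rw [← pr_coord p (e, i)]
  congr 1; ext ω
  exact ⟨fun ⟨_, h⟩ => h, fun h => ⟨i.2, h⟩⟩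

lemma pr_newAt_le (h0 : ∀ x, 0 ≤ p x) (h1 : ∀ x, p x ≤ 1) (i : Fin T) (e : E) :
    pr p (fun ω => NewAt 𝓑 ω i e) ≤ p (e, i) * pr p (fun ω => Avail 𝓑 (rm e ω) i e) := by
  rw [← pr_lab (p := p) i e, ← pr_and p (A := {x | x.1 = e ∧ x.2 = i}) (B := {x | x.1 ≠ e}) _
    (by simpa only [Fin.ext_iff] using dependsOn_lab (T := T) i e)
    (dependsOn_rm (fun ω => Avail 𝓑 ω i e) e)]
  · exact pr_mono h0 h1 fun ω h => ⟨h.1.1, h.avail_rm⟩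
  · rw [Set.disjoint_left]
    exact fun x hx h => h hx.1

lemma pr_mem_acc_le (h0 : ∀ x, 0 ≤ p x) (h1 : ∀ x, p x ≤ 1) {m : ℕ} (hm : m ≤ T) {c : ℝ} {e : E}
    (hc : ∀ i : Fin T, i < m → p (e, i) * pr p (fun ω => Avail 𝓑 (rm e ω) i e) ≤ c) {i : ℕ}
    (hi : i ≤ m) : pr p (fun ω => e ∈ acc 𝓑 ω i) ≤ i * c := by
  induction i with
  | zero => simp [acc, pr, ex_const]
  | succ i ih =>
    have h2 := (pr_newAt_le (𝓑 := 𝓑) h0 h1 ⟨i, by omega⟩ e).trans (hc ⟨i, by omega⟩ hi)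
    have h3 := pr_or_le h0 h1 (fun ω => e ∈ acc 𝓑 ω i) (fun ω => NewAt 𝓑 ω i e)
    have h4 := ih (by omega)
    simp only [mem_acc_succ]
    push_cast
    linarith

lemma le_pr_forall_not_lab (h0 : ∀ x, 0 ≤ p x) (h1 : ∀ x, p x ≤ 1) {y : ℝ} (hy : ∀ x, p x ≤ y)
    (e : E) (s : Finset (Fin T)) :
    1 - T * y ≤ pr p (fun ω => ∀ i ∈ s, ¬ Lab ω i e) := by
  have h2 : (fun ω : E × Fin T → Bool => ∀ i ∈ s, ¬ Lab ω i e) =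
      fun ω => ¬ ∃ i ∈ s, Lab ω i e := by
    ext ω; push Not; rfl
  rw [h2, pr_not]
  have h3 := pr_exists_le h0 h1 s (fun i ω => Lab ω i e)
  have h4 : ∑ i ∈ s, pr p (fun ω => Lab ω i e) ≤ ∑ i : Fin T, y := by
    refine (sum_le_sum fun i _ => ?_).trans
      (sum_le_sum_of_subset_of_nonneg (subset_univ s) fun i _ _ => (h0 (e, i)).trans (hy _))
    rw [pr_lab]
    exact hy _
  simp only [sum_const, card_univ, Fintype.card_fin, nsmul_eq_mul] at h4
  linarith

lemma pr_mem_acc_rm_mul_le (h0 : ∀ x, 0 ≤ p x) (h1 : ∀ x, p x ≤ 1) {y : ℝ} (hy : ∀ x, p x ≤ y)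
    (e f : E) (i : ℕ) :
    pr p (fun ω => f ∈ acc 𝓑 (rm e ω) i) * (1 - T * y) ≤ pr p (fun ω => f ∈ acc 𝓑 ω i) := by
  refine (mul_le_mul_of_nonneg_left (le_pr_forall_not_lab h0 h1 hy e univ)
    (pr_nonneg h0 h1 _)).trans ?_
  rw [← pr_and p (A := {x | x.1 ≠ e}) (B := {x | x.1 = e}) _
    (dependsOn_rm (fun ω => f ∈ acc 𝓑 ω i) e)]
  · refine pr_mono h0 h1 fun ω h => ?_
    rw [← rm_eq_of_not_lab (ω := ω) (e := e)]
    · exact h.1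
    · exact fun j hj => h.2 ⟨j, hj.1⟩ (mem_univ _) hj
  · intro ω ω' h
    refine propext (forall₂_congr fun j _ => not_congr (iff_of_eq (dependsOn_lab j e ?_)))
    exact fun x hx => h x hx.1
  · rw [Set.disjoint_left]
    exact fun x hx h => hx h

lemma le_pr_avail_rm {V : E → Finset β} {C : ℕ} {D K : ℝ} (hS : LocallySparse 𝓑 V T C D K)
    (h0 : ∀ x, 0 ≤ p x) (h1 : ∀ x, p x ≤ 1) (hD : 2 ≤ D) {η : ℝ} (hη : 0 < η) (hη1 : η ≤ 1)
    {m : ℕ} (hm : m ≤ T) (e : E)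
    (hq : ∀ f, pr p (fun ω => f ∈ acc 𝓑 (rm e ω) m) * D ≤ 1 - η) :
    η ^ C * Real.exp (-2 * K) ≤ pr p (fun ω => Avail 𝓑 (rm e ω) m e) := by
  classical
  have hD0 : 0 < D := by linarith
  set u : E → ℝ := fun f => pr p (fun ω => f ∈ acc 𝓑 (rm e ω) m) with hu
  have hu0 : ∀ f, 0 ≤ u f := fun f => pr_nonneg h0 h1 _
  have huD : ∀ f, u f ≤ D⁻¹ := fun f => by
    rw [← one_div, le_div_iff₀ hD0]
    linarith [hq f]
  have hreach : ∀ f, DependsOn (fun ω : E × Fin T → Bool => f ∈ acc 𝓑 (rm e ω) m)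
      {x | x.1 ∈ reach 𝓑 e T f} := fun f ω ω' h =>
    dependsOn_mem_acc_rm e m f fun x hx => h x (reach_mono 𝓑 e f hm hx)
  set L := 𝓑.filter (fun B => e ∈ B ∧ 3 ≤ B.card) with hL
  let κ := (V e).disjSum L
  let good : β ⊕ Finset E → (E × Fin T → Bool) → Prop := fun k ω => match k with
    | Sum.inl S => ∀ f, f ≠ e → S ∈ V f → f ∉ acc 𝓑 (rm e ω) m
    | Sum.inr B => ¬ ∀ f ∈ B.erase e, f ∈ acc 𝓑 (rm e ω) m
  let M : β ⊕ Finset E → Set E := fun k => match k with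
    | Sum.inl S => {f | f ≠ e ∧ S ∈ V f}
    | Sum.inr B => {f | f ≠ e ∧ f ∈ B}
  let R : β ⊕ Finset E → Set (E × Fin T) := fun k => {x | ∃ f ∈ M k, x.1 ∈ reach 𝓑 e T f}
  have hdep : ∀ k ∈ κ, DependsOn (good k) (R k) := by
    rintro (S | B) _ ω ω' h
    · refine propext (forall_congr' fun f => forall₂_congr fun hfe hf => not_congr (iff_of_eq ?_))
      exact hreach f fun x hx => h x ⟨f, ⟨hfe, hf⟩, hx⟩
    · refine propext (not_congr (forall₂_congr fun f hf => iff_of_eq ?_))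
      exact hreach f fun x hx => h x ⟨f, mem_erase.1 hf, hx⟩
  have hMdisj : ∀ k ∈ κ, ∀ l ∈ κ, k ≠ l → ∀ f ∈ M k, ∀ f' ∈ M l,
      Disjoint (reach 𝓑 e T f) (reach 𝓑 e T f') := by
    rintro (S | B) hk (S' | B') hl hkl f hf f' hf'
    · simp only [κ, inl_mem_disjSum] at hk hl
      exact hS.disjoint_star e S hk S' hl (fun h => hkl (h ▸ rfl)) f hf.1 f' hf'.1 hf.2 hf'.2
    · simp only [κ, inl_mem_disjSum, inr_mem_disjSum, hL, mem_filter] at hk hl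
      exact hS.disjoint_star_block e S hk B' hl.1 hl.2.1 hl.2.2 f hf.1 hf.2 f' hf'.2 hf'.1
    · simp only [κ, inl_mem_disjSum, inr_mem_disjSum, hL, mem_filter] at hk hl
      exact (hS.disjoint_star_block e S' hl B hk.1 hk.2.1 hk.2.2 f' hf'.1 hf'.2 f hf.2 hf.1).symm
    · simp only [κ, inr_mem_disjSum, hL, mem_filter] at hk hl
      exact hS.disjoint_block e B hk.1 B' hl.1 hk.2.1 hl.2.1 hk.2.2 hl.2.2 (fun h => hkl (h ▸ rfl))
        f hf.2 hf.1 f' hf'.2 hf'.1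
  have hRdisj : ∀ k ∈ κ, ∀ l ∈ κ, k ≠ l → Disjoint (R k) (R l) := by
    intro k hk l hl hkl
    rw [Set.disjoint_left]
    rintro x ⟨f, hf, hx⟩ ⟨f', hf', hx'⟩
    exact Set.disjoint_left.1 (hMdisj k hk l hl hkl f hf f' hf') hx hx'
  have hprod := pr_forall p κ hdep hRdisj
  have hstep : pr p (fun ω => ∀ k ∈ κ, good k ω) ≤ pr p (fun ω => Avail 𝓑 (rm e ω) m e) := by
    refine pr_mono h0 h1 fun ω h B hB heB => ?_
    rcases (hS.two_le_card B hB).eq_or_lt with h2 | h2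
    · obtain ⟨a, b, hab, rfl⟩ := card_eq_two.1 h2.symm
      wlog hea : e = a generalizing a b
      · have := this b a hab.symm (by rwa [pair_comm]) (by rwa [pair_comm])
          (by rw [pair_comm]; exact h2) (by simp at heB; tauto)
        rwa [pair_comm]
      subst hea
      obtain ⟨S, hSe, hSb⟩ := hS.pair e b hab hB
      exact ⟨b, by simp, hab.symm, h (Sum.inl S) (by simpa [κ] using hSe) b hab.symm hSb⟩
    · have := h (Sum.inr B) (by simp [κ, hL, hB, heB]; omega)
      simp only [good] at this
      push Not at this
      obtain ⟨f, hf, hf'⟩ := this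
      exact ⟨f, mem_of_mem_erase hf, ne_of_mem_erase hf, hf'⟩
  refine le_trans ?_ hstep
  rw [hprod, prod_disjSum]
  have hstar : ∀ S ∈ V e, η ≤ pr p (good (Sum.inl S)) := by
    intro S hSe
    set s := univ.filter (fun f => f ≠ e ∧ S ∈ V f)
    have h2 : good (Sum.inl S) = fun ω => ¬ ∃ f ∈ s, f ∈ acc 𝓑 (rm e ω) m := by
      ext ω
      simp [good, s]
    rw [h2, pr_not]
    have h3 := pr_exists_le h0 h1 s (fun f ω => f ∈ acc 𝓑 (rm e ω) m)
    have h4 : ∑ f ∈ s, u f ≤ ∑ f ∈ s, (1 - η) / D := sum_le_sum fun f _ => by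
      rw [le_div_iff₀ hD0]; exact hq f
    rw [sum_const, nsmul_eq_mul] at h4
    have h5 : (s.card : ℝ) ≤ D := hS.degree e S hSe s (by simp [s])
    have h6 : (s.card : ℝ) * ((1 - η) / D) ≤ D * ((1 - η) / D) :=
      mul_le_mul_of_nonneg_right h5 (div_nonneg (by linarith) hD0.le)
    rw [mul_div_cancel₀ _ hD0.ne'] at h6
    linarith
  have hblock : ∀ B ∈ L, Real.exp (-2 * (D⁻¹) ^ (B.card - 1)) ≤ pr p (good (Sum.inr B)) := by
    intro B hB
    simp only [hL, mem_filter] at hB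
    have h2 : pr p (good (Sum.inr B)) = 1 - ∏ f ∈ B.erase e, u f := by
      rw [← pr_forall p (B.erase e) (R := fun f => {x | x.1 ∈ reach 𝓑 e T f})
        (fun f _ => hreach f), ← pr_not]
      intro f hf f' hf' hff
      have := hS.disjoint_mem B hB.1 e hB.2.1 f (mem_of_mem_erase hf) f' (mem_of_mem_erase hf')
        (ne_of_mem_erase hf) (ne_of_mem_erase hf') hff
      rw [Set.disjoint_left] at this ⊢
      exact fun x hx hx' => this hx hx'
    have h3 : ∏ f ∈ B.erase e, u f ≤ (D⁻¹) ^ (B.card - 1) := by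
      rw [← card_erase_of_mem hB.2.1, ← prod_const]
      exact prod_le_prod (fun f _ => hu0 f) fun f _ => huD f
    have h4 : (D⁻¹) ^ (B.card - 1) ≤ 1 / 2 := by
      have h5 : D⁻¹ ≤ 1 / 2 := by rw [one_div]; exact inv_anti₀ (by norm_num) hD
      refine (pow_le_of_le_one (by positivity) (by linarith) (by omega)).trans h5
    have h5 : 0 ≤ (D⁻¹) ^ (B.card - 1) := by positivity
    set x := (D⁻¹) ^ (B.card - 1)
    have h6 : Real.exp (-2 * x) ≤ 1 - x := by
      have h7 := Real.add_one_le_exp (2 * x)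
      rw [show -2 * x = -(2 * x) by ring, Real.exp_neg, inv_le_comm₀ (Real.exp_pos _) (by linarith)]
      refine le_trans ?_ h7
      rw [inv_le_iff_one_le_mul₀ (by linarith)]
      nlinarith
    rw [h2]; linarith
  refine mul_le_mul ?_ ?_ (Real.exp_pos _).le (prod_nonneg fun _ _ => pr_nonneg h0 h1 _)
  · calc η ^ C ≤ η ^ (V e).card := pow_le_pow_of_le_one hη.le hη1 (hS.card_V e)
      _ = ∏ S ∈ V e, η := by rw [prod_const]
      _ ≤ _ := prod_le_prod (fun _ _ => hη.le) hstar
  · calc Real.exp (-2 * K) ≤ Real.exp (∑ B ∈ L, -2 * (D⁻¹) ^ (B.card - 1)) := by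
          rw [Real.exp_le_exp, ← mul_sum]
          have : ∑ B ∈ L, (D⁻¹) ^ (B.card - 1) ≤ ∑ B ∈ 𝓑 with e ∈ B, (D⁻¹) ^ (B.card - 1) := by
            refine sum_le_sum_of_subset_of_nonneg (fun B hB => ?_) fun _ _ _ => by positivity
            simp only [hL, mem_filter] at hB ⊢
            exact ⟨hB.1, hB.2.1⟩
          linarith [hS.weight e]
      _ = ∏ B ∈ L, Real.exp (-2 * (D⁻¹) ^ (B.card - 1)) := Real.exp_sum _ _
      _ ≤ _ := prod_le_prod (fun _ _ => (Real.exp_pos _).le) hblock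

end Nibble

namespace Nibble
open Bernoulli

variable {E β : Type*} {T : ℕ} [Fintype E] [DecidableEq E] {𝓑 : Finset (Finset E)}
variable {p : E × Fin T → ℝ}

lemma pr_clash_rm_le {V : E → Finset β} {C : ℕ} {D K : ℝ} (hS : LocallySparse 𝓑 V T C D K)
    (h0 : ∀ x, 0 ≤ p x) (h1 : ∀ x, p x ≤ 1) (hD : 0 < D) {y : ℝ} (hy : ∀ x, p x ≤ y)
    (hy0 : 0 ≤ y) (hyD : y ≤ D⁻¹) (i : Fin T) (e : E)
    (hq : ∀ f, pr p (fun ω => f ∈ acc 𝓑 (rm e ω) i) ≤ D⁻¹) :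
    pr p (fun ω => Clash 𝓑 (rm e ω) i e) ≤ 12 * (y * D) * K := by
  classical
  let ev : E → E → (E × Fin T → Bool) → Prop := fun f f' ω =>
    if f' = f then Lab (rm e ω) i f' else f' ∈ acc 𝓑 (rm e ω) i ∨ Lab (rm e ω) i f'
  have hlabdep : ∀ f', DependsOn (fun ω : E × Fin T → Bool => Lab (rm e ω) i f')
      {x | x.1 ∈ reach 𝓑 e T f'} := fun f' ω ω' h =>
    dependsOn_lab (T := T) i f' fun x hx => by
      simp only [rm]
      rw [h x (by rw [Set.mem_ofPred, hx.1]; exact mem_reach_self)]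
  have haccdep : ∀ f', DependsOn (fun ω : E × Fin T → Bool => f' ∈ acc 𝓑 (rm e ω) i)
      {x | x.1 ∈ reach 𝓑 e T f'} := fun f ω ω' h =>
    dependsOn_mem_acc_rm e i f fun x hx => h x (reach_mono 𝓑 e f i.2.le hx)
  have hdep : ∀ f f', DependsOn (ev f f') {x | x.1 ∈ reach 𝓑 e T f'} := by
    intro f f' ω ω' h
    have h2 := hlabdep f' h
    have h3 := haccdep f' h
    simp only at h2 h3
    simp only [ev, h2, h3]
  have hlab : ∀ f, f ≠ e → pr p (fun ω => Lab (rm e ω) i f) ≤ y := by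
    intro f hf
    have h2 : (fun ω : E × Fin T → Bool => Lab (rm e ω) i f) = fun ω => Lab ω i f := by
      ext ω; exact lab_rm hf
    rw [h2, pr_lab]
    exact hy _
  have hterm : ∀ B ∈ 𝓑, e ∈ B → ∀ f ∈ B.erase e,
      pr p (fun ω => ∀ f' ∈ B.erase e, ev f f' ω) ≤ y * (2 * D⁻¹) ^ (B.card - 2) := by
    intro B hB heB f hf
    rw [pr_forall p (B.erase e) (fun f' _ => hdep f f'), ← mul_prod_erase _ _ hf]
    · refine mul_le_mul ?_ ?_ (prod_nonneg fun _ _ => pr_nonneg h0 h1 _) hy0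
      · simpa [ev] using hlab f (ne_of_mem_erase hf)
      · have hc : ((B.erase e).erase f).card = B.card - 2 := by
          rw [card_erase_of_mem hf, card_erase_of_mem heB]; omega
        rw [← hc, ← prod_const]
        refine prod_le_prod (fun _ _ => pr_nonneg h0 h1 _) fun f' hf' => ?_
        have hne := ne_of_mem_erase hf'
        have hne' := ne_of_mem_erase (mem_of_mem_erase hf')
        simp only [ev, if_neg hne]
        have h2 := pr_or_le h0 h1 (fun ω => f' ∈ acc 𝓑 (rm e ω) i) (fun ω => Lab (rm e ω) i f')
        linarith [hq f', hlab f' hne']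
    · intro f₁ hf₁ f₂ hf₂ hff
      have := hS.disjoint_mem B hB e heB f₁ (mem_of_mem_erase hf₁) f₂ (mem_of_mem_erase hf₂)
        (ne_of_mem_erase hf₁) (ne_of_mem_erase hf₂) hff
      rw [Set.disjoint_left] at this ⊢
      exact fun x hx hx' => this hx hx'
  have hsub : pr p (fun ω => Clash 𝓑 (rm e ω) i e) ≤
      pr p (fun ω => ∃ B ∈ 𝓑.filter (e ∈ ·), ∃ f ∈ B.erase e, ∀ f' ∈ B.erase e, ev f f' ω) := by
    refine pr_mono h0 h1 fun ω ⟨B, hB, heB, f, hf, hfe, hlf, h⟩ => ?_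
    refine ⟨B, mem_filter.2 ⟨hB, heB⟩, f, mem_erase.2 ⟨hfe, hf⟩, fun f' hf' => ?_⟩
    by_cases hff : f' = f
    · subst hff; simpa [ev] using hlf
    · simpa [ev, hff] using h f' (mem_of_mem_erase hf') (ne_of_mem_erase hf') hff
  have hblock : ∀ B ∈ 𝓑.filter (e ∈ ·),
      pr p (fun ω => ∃ f ∈ B.erase e, ∀ f' ∈ B.erase e, ev f f' ω) ≤
        12 * (y * D) * (D⁻¹) ^ (B.card - 1) := by
    intro B hB
    rw [mem_filter] at hB
    refine (pr_exists_le h0 h1 _ _).trans ((sum_le_sum (hterm B hB.1 hB.2)).trans ?_)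
    rw [sum_const, card_erase_of_mem hB.2, nsmul_eq_mul]
    have h2 := hS.two_le_card B hB.1
    have h4 := hS.card_le_four B hB.1
    have hDD : D * D⁻¹ = 1 := mul_inv_cancel₀ hD.ne'
    have hpos : 0 ≤ D⁻¹ := by positivity
    have hrw : ∀ k, 12 * (y * D) * (D⁻¹) ^ (k + 1) = 12 * (y * (D⁻¹) ^ k) := fun k => by
      rw [pow_succ]; linear_combination 12 * y * D⁻¹ ^ k * hDD
    obtain h | h | h : B.card = 2 ∨ B.card = 3 ∨ B.card = 4 := by omega
    · rw [h, hrw 0]; norm_num; linarith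
    · rw [h, hrw 1]; norm_num; nlinarith [mul_nonneg hy0 hpos]
    · rw [h, hrw 2]; refine le_of_eq ?_; norm_num; ring
  refine hsub.trans ((pr_exists_le h0 h1 _ _).trans ((sum_le_sum hblock).trans ?_))
  rw [← mul_sum]
  exact mul_le_mul_of_nonneg_left (hS.weight e) (by positivity)

section Parameters

variable {V : E → Finset β} {C : ℕ} {D K δ c g : ℝ}

lemma acc_rm_and_avail_bounds (hS : LocallySparse 𝓑 V T C D K) (h0 : ∀ x, 0 ≤ p x)
    (hδ0 : 0 < δ) (hδ1 : δ < 1) (hD : 2 ≤ D) (hg : g = (δ / 2) ^ C * Real.exp (-2 * K))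
    (hc : 0 ≤ c) (hTc : T * c * D ≤ 1 - δ) (hy1 : c / g ≤ 1) (hTy : T * (c / g) ≤ δ / 2)
    (hpy : ∀ x, p x ≤ c / g) {m : ℕ} (hm : m ≤ T)
    (hpa : ∀ i : Fin T, i < m → ∀ e, p (e, i) * pr p (fun ω => Avail 𝓑 (rm e ω) i e) = c) :
    (∀ e f, pr p (fun ω => f ∈ acc 𝓑 (rm e ω) m) * D ≤ 1 - δ / 2) ∧
      ∀ e, g ≤ pr p (fun ω => Avail 𝓑 (rm e ω) m e) := by
  have h1 : ∀ x, p x ≤ 1 := fun x => (hpy x).trans hy1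
  have hq : ∀ e f, pr p (fun ω => f ∈ acc 𝓑 (rm e ω) m) * D ≤ 1 - δ / 2 := by
    intro e f
    have h2 := pr_mem_acc_rm_mul_le (𝓑 := 𝓑) h0 h1 hpy e f m
    have h3 := pr_mem_acc_le (𝓑 := 𝓑) h0 h1 hm (fun i hi => (hpa i hi f).le) le_rfl
    have h4 : (m : ℝ) * c ≤ T * c := mul_le_mul_of_nonneg_right (by exact_mod_cast hm) hc
    have h5 := pr_nonneg h0 h1 (fun ω => f ∈ acc 𝓑 (rm e ω) m)
    set u := pr p (fun ω => f ∈ acc 𝓑 (rm e ω) m)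
    have h6 : u * (1 - δ / 2) ≤ T * c :=
      (mul_le_mul_of_nonneg_left (by linarith) h5).trans (h2.trans (h3.trans h4))
    have h7 : u * D * (1 - δ / 2) ≤ (1 - δ / 2) * (1 - δ / 2) := by
      have := mul_le_mul_of_nonneg_right h6 (by linarith : (0 : ℝ) ≤ D)
      nlinarith
    exact le_of_mul_le_mul_right h7 (by linarith)
  refine ⟨hq, fun e => ?_⟩
  rw [hg]
  exact le_pr_avail_rm hS h0 h1 hD (by linarith) (by linarith) hm e (hq e)

/-- Labelling probabilities can be chosen so that every element is accepted in every round with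
almost the same probability `c`. -/
lemma exists_params (hS : LocallySparse 𝓑 V T C D K)
    (hδ0 : 0 < δ) (hδ1 : δ < 1) (hD : 2 ≤ D) (hg : g = (δ / 2) ^ C * Real.exp (-2 * K))
    (hc : 0 ≤ c) (hTc : T * c * D ≤ 1 - δ) (hy1 : c / g ≤ 1) (hTy : T * (c / g) ≤ δ / 2)
    (m : ℕ) (hm : m ≤ T) :
    ∃ p : E × Fin T → ℝ, (∀ x, 0 ≤ p x) ∧ (∀ x, p x ≤ c / g) ∧
      ∀ i : Fin T, i < m → ∀ e, p (e, i) * pr p (fun ω => Avail 𝓑 (rm e ω) i e) = c := by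
  classical
  have hg0 : 0 < g := by rw [hg]; positivity
  induction m with
  | zero => exact ⟨fun _ => 0, fun _ => le_rfl, fun _ => by positivity, fun i hi => by omega⟩
  | succ m ih =>
    obtain ⟨p, h0, hpy, hpa⟩ := ih (by omega)
    have ha := (acc_rm_and_avail_bounds hS h0 hδ0 hδ1 hD hg hc hTc hy1 hTy hpy (by omega) hpa).2
    let q : E × Fin T → ℝ := fun x =>
      if (x.2 : ℕ) = m then c / pr p (fun ω => Avail 𝓑 (rm x.1 ω) m x.1) else p x
    have hqp : ∀ i ≤ m, ∀ e, pr q (fun ω => Avail 𝓑 (rm e ω) i e) =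
        pr p (fun ω => Avail 𝓑 (rm e ω) i e) := by
      intro i hi e
      refine ex_congr (A := {x | (x.2 : ℕ) < i}) (fun x hx => ?_) ?_
      · have : (x.2 : ℕ) ≠ m := (lt_of_lt_of_le hx hi).ne
        simp [q, this]
      · intro ω ω' h
        have := dependsOn_avail_rm (𝓑 := 𝓑) i e h
        simp only at this
        simp only [this]
    refine ⟨q, fun x => ?_, fun x => ?_, fun i hi e => ?_⟩
    · simp only [q]
      split_ifs
      · exact div_nonneg hc (hg0.le.trans (ha _))
      · exact h0 x
    · simp only [q]
      split_ifs
      · exact div_le_div_of_nonneg_left hc hg0 (ha _)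
      · exact hpy x
    · rw [hqp i (by omega) e]
      by_cases him : (i : ℕ) = m
      · simp only [q, him, if_true]
        exact div_mul_cancel₀ _ (hg0.trans_le (ha e)).ne'
      · simp only [q, him, if_false]
        exact hpa i (by omega) e

lemma le_pr_newAt (hS : LocallySparse 𝓑 V T C D K) (h0 : ∀ x, 0 ≤ p x)
    (hδ0 : 0 < δ) (hδ1 : δ < 1) (hD : 2 ≤ D) (hg : g = (δ / 2) ^ C * Real.exp (-2 * K))
    (hc : 0 ≤ c) (hTc : T * c * D ≤ 1 - δ) (hyD : c / g ≤ D⁻¹) (hTy : T * (c / g) ≤ δ / 2)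
    (hyK : 12 * (c / g * D) * K ≤ g * (δ / 2))
    (hpy : ∀ x, p x ≤ c / g)
    (hpa : ∀ i : Fin T, i < T → ∀ e, p (e, i) * pr p (fun ω => Avail 𝓑 (rm e ω) i e) = c)
    (i : Fin T) (e : E) : c * (1 - δ) ≤ pr p (fun ω => NewAt 𝓑 ω i e) := by
  have hD0 : 0 < D := by linarith
  have hg0 : 0 < g := by rw [hg]; positivity
  have hy1 : c / g ≤ 1 := hyD.trans (inv_le_one_of_one_le₀ (by linarith))
  have h1 : ∀ x, p x ≤ 1 := fun x => (hpy x).trans hy1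
  obtain ⟨hq, -⟩ := acc_rm_and_avail_bounds hS h0 hδ0 hδ1 hD hg hc hTc hy1 hTy hpy
    i.2.le (fun j hj e => hpa j (hj.trans i.2) e)
  have hclash := pr_clash_rm_le hS h0 h1 hD0 hpy (by positivity) hyD i e (fun f => by
    rw [← one_div, le_div_iff₀ hD0]; linarith [hq e f])
  have hFdep : DependsOn (fun ω : E × Fin T → Bool => FirstAt ω i e) {x | x.1 = e} :=
    fun ω ω' h => dependsOn_firstAt (T := T) i e fun x hx => h x hx.1
  have hdisj : Disjoint {x : E × Fin T | x.1 = e} {x | x.1 ≠ e} := by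
    rw [Set.disjoint_left]
    exact fun x hx h => h hx
  have hFA := pr_and p hdisj hFdep (dependsOn_rm (fun ω => Avail 𝓑 ω i e) e)
  have hFC := pr_and p hdisj hFdep (dependsOn_rm (fun ω => Clash 𝓑 ω i e) e)
  have hsplit : pr p (fun ω => FirstAt ω i e ∧ Avail 𝓑 (rm e ω) i e) ≤
      pr p (fun ω => NewAt 𝓑 ω i e) + pr p (fun ω => FirstAt ω i e ∧ Clash 𝓑 (rm e ω) i e) := by
    refine le_trans (pr_mono h0 h1 fun ω h => ?_) (pr_or_le h0 h1 _ _)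
    rcases newAt_or_clash h.1 h.2 with h' | h'
    · exact Or.inl h'
    · exact Or.inr ⟨h.1, h'⟩
  have hFle : pr p (fun ω => FirstAt ω i e) ≤ c / g := by
    refine (pr_mono h0 h1 fun ω h => h.1).trans ?_
    rw [pr_lab]
    exact hpy _
  have hFge : p (e, i) * (1 - δ / 2) ≤ pr p (fun ω => FirstAt ω i e) := by
    have h2 := le_pr_forall_not_lab h0 h1 hpy e (univ.filter (· < i))
    have h3 := pr_and p (A := {x | x.1 = e ∧ x.2 = i}) (B := {x | x.1 = e ∧ x.2 < i})
      (s := fun ω => Lab ω i e) (t := fun ω => ∀ j ∈ univ.filter (· < i), ¬ Lab ω j e)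
      (by
        rw [Set.disjoint_left]
        exact fun x hx h => h.2.ne hx.2)
      (by simpa only [Fin.ext_iff] using dependsOn_lab (T := T) i e)
      (by
        intro ω ω' h
        refine propext (forall₂_congr fun j hj => not_congr (iff_of_eq (dependsOn_lab j e ?_)))
        intro x hx
        refine h x ⟨hx.1, ?_⟩
        rw [Fin.ext hx.2]
        simpa using hj)
    have h4 : (fun ω : E × Fin T → Bool => FirstAt ω i e) =
        fun ω => Lab ω i e ∧ ∀ j ∈ univ.filter (· < i), ¬ Lab ω j e := by
      ext ω
      refine and_congr_right fun _ => ⟨fun h j hj => h j (by simpa using hj), fun h j hj => ?_⟩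
      exact h ⟨j, hj.trans i.2⟩ (mem_filter.2 ⟨mem_univ _, hj⟩)
    rw [h4, h3, pr_lab]
    exact mul_le_mul_of_nonneg_left (by linarith) (h0 _)
  set a := pr p (fun ω => Avail 𝓑 (rm e ω) i e)
  set F := pr p (fun ω => FirstAt ω i e)
  have ha0 : 0 ≤ a := pr_nonneg h0 h1 _
  have h5 : c * (1 - δ / 2) ≤ F * a := by
    calc c * (1 - δ / 2) = p (e, i) * (1 - δ / 2) * a := by rw [← hpa i i.2 e]; ring
      _ ≤ F * a := mul_le_mul_of_nonneg_right hFge ha0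
  have h6 : F * pr p (fun ω => Clash 𝓑 (rm e ω) i e) ≤ c * (δ / 2) := by
    calc F * pr p (fun ω => Clash 𝓑 (rm e ω) i e) ≤ c / g * (g * (δ / 2)) :=
          mul_le_mul hFle (hclash.trans hyK) (pr_nonneg h0 h1 _) (by positivity)
      _ = c * (δ / 2) := by field_simp
  linarith

end Parameters

theorem exists_block_free {δ : ℝ} (hδ0 : 0 < δ) (hδ1 : δ < 1) (C : ℕ) {K : ℝ} (hK : 0 ≤ K) :
    ∃ (T : ℕ) (D₀ : ℝ), ∀ (E β : Type) [Fintype E] [DecidableEq E] (𝓑 : Finset (Finset E))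
      (V : E → Finset β) (D : ℝ), D₀ ≤ D → LocallySparse 𝓑 V T C D K →
      ∃ M : Finset E, (∀ B ∈ 𝓑, ¬ B ⊆ M) ∧ (1 - 2 * δ) * Fintype.card E ≤ M.card * D := by
  classical
  set g := (δ / 2) ^ C * Real.exp (-2 * K) with hg
  have hg0 : 0 < g := by positivity
  obtain ⟨T, hT⟩ := exists_nat_ge (1 / g + 24 * K / (g ^ 2 * δ) + 1)
  have hT0 : (0 : ℝ) < T := lt_of_lt_of_le (by positivity) hT
  have hT1 : 1 / g ≤ T := by
    have : 0 ≤ 24 * K / (g ^ 2 * δ) := by positivity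
    linarith
  have hT2 : 24 * K / (g ^ 2 * δ) ≤ T := by
    have : 0 ≤ 1 / g := by positivity
    linarith
  rw [div_le_iff₀ hg0] at hT1
  rw [div_le_iff₀ (by positivity)] at hT2
  refine ⟨T, max 2 (2 / (δ * g)), fun E β _ _ 𝓑 V D hD hS => ?_⟩
  have hD2 : 2 ≤ D := (le_max_left _ _).trans hD
  have hD0 : 0 < D := by linarith
  have hDg : 2 ≤ D * (δ * g) := by
    rw [← div_le_iff₀ (by positivity)]; exact (le_max_right _ _).trans hD
  set c := (1 - δ) / (T * D) with hc
  have hc0 : 0 ≤ c := div_nonneg (by linarith) (by positivity)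
  have hcTD : T * c * D = 1 - δ := by rw [hc]; field_simp
  have hcg : c / g * D = (1 - δ) / (T * g) := by rw [hc]; field_simp
  have hcT : T * (c / g) = (1 - δ) / (D * g) := by rw [hc]; field_simp
  have hyD : c / g ≤ D⁻¹ := by
    rw [← one_div, le_div_iff₀ hD0, hcg, div_le_one (by positivity)]
    linarith
  have hTy : T * (c / g) ≤ δ / 2 := by
    rw [hcT, div_le_iff₀ (by positivity)]
    nlinarith
  have hyK : 12 * (c / g * D) * K ≤ g * (δ / 2) := by
    rw [hcg, mul_div_assoc', div_mul_eq_mul_div, div_le_iff₀ (by positivity)]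
    nlinarith [mul_nonneg hδ0.le hK]
  have hy1 : c / g ≤ 1 := hyD.trans (inv_le_one_of_one_le₀ (by linarith))
  obtain ⟨p, h0, hpy, hpa⟩ := exists_params hS hδ0 hδ1 hD2 hg hc0 hcTD.le hy1 hTy T le_rfl
  have h1 : ∀ x, p x ≤ 1 := fun x => (hpy x).trans hy1
  have hnew := le_pr_newAt hS h0 hδ0 hδ1 hD2 hg hc0 hcTD.le hyD hTy hyK hpy hpa
  have hacc : ∀ e, (1 - 2 * δ) / D ≤ pr p (fun ω => e ∈ acc 𝓑 ω T) := by
    intro e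
    have h2 : ∑ i : Fin T, pr p (fun ω => NewAt 𝓑 ω i e) ≤ pr p (fun ω => e ∈ acc 𝓑 ω T) := by
      simp only [pr]
      rw [← ex_sum]
      refine ex_mono h0 h1 fun ω => ?_
      by_cases h : ∃ i : Fin T, NewAt 𝓑 ω i e
      · obtain ⟨i, hi⟩ := h
        rw [sum_eq_single i, if_pos hi, if_pos (hi.mem_acc i.2)]
        · exact fun j _ hj => if_neg fun h => hj (Fin.ext (h.1.unique hi.1))
        · simp
      · push Not at h
        rw [sum_eq_zero fun i _ => if_neg (h i)]
        split_ifs <;> norm_num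
    refine le_trans ?_ h2
    calc (1 - 2 * δ) / D ≤ (1 - δ) * (1 - δ) / D := by gcongr; nlinarith
      _ = ∑ i : Fin T, c * (1 - δ) := by
        simp only [sum_const, card_univ, Fintype.card_fin, nsmul_eq_mul]
        rw [hc]; field_simp
      _ ≤ _ := sum_le_sum fun i _ => hnew i e
  obtain ⟨ω, hω⟩ := exists_ex_le h0 h1 (fun ω => ∑ e, if e ∈ acc 𝓑 ω T then (1 : ℝ) else 0)
  rw [ex_sum] at hω
  refine ⟨univ.filter (· ∈ acc 𝓑 ω T), fun B hB hsub => ?_, ?_⟩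
  · have hne : B.Nonempty := card_pos.1 (by have := hS.two_le_card B hB; omega)
    exact not_block_subset_acc hB hne fun f hf => (mem_filter.1 (hsub hf)).2
  · have h3 : ∑ e : E, (1 - 2 * δ) / D ≤ ∑ e, pr p (fun ω => e ∈ acc 𝓑 ω T) :=
      sum_le_sum fun e _ => hacc e
    have h4 := h3.trans hω
    rw [sum_boole, sum_const, card_univ, nsmul_eq_mul, mul_div_assoc', div_le_iff₀ hD0] at h4
    linarith

end Nibble

namespace Tight
open Nibble

variable {E α : Type*} [DecidableEq E] [DecidableEq α] (φ : E → Finset α) (s t : ℕ)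

/-- A nonempty set of `k` edges is tight if it spans at most `k * s + t` vertices. -/
def IsTight (X : Finset E) : Prop := X.Nonempty ∧ (X.sup φ).card ≤ X.card * s + t

/-- A block is a tight set of two to four edges that is minimal with respect to inclusion among
tight sets with at least two edges. -/
def IsBlock (B : Finset E) : Prop :=
  2 ≤ B.card ∧ B.card ≤ 4 ∧ IsTight φ s t B ∧ ∀ Y ⊆ B, 2 ≤ Y.card → IsTight φ s t Y → Y = B

open Classical in
/-- The set of all blocks. -/
noncomputable def blocks [Fintype E] : Finset (Finset E) := univ.filter (IsBlock φ s t)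

/-- Every nonempty set of `k ≤ G` edges spans at least `k * s + t` vertices. -/
def NoDense (G : ℕ) : Prop :=
  ∀ X : Finset E, X.Nonempty → X.card ≤ G → X.card * s + t ≤ (X.sup φ).card

variable {φ s t} {G : ℕ} {X Y B B' : Finset E} {e f f' : E}

lemma IsTight.exists_block (hX : IsTight φ s t X) (h2 : 2 ≤ X.card) (h4 : X.card ≤ 4) :
    ∃ B ⊆ X, IsBlock φ s t B := by
  induction hn : X.card using Nat.strong_induction_on generalizing X with
  | _ n ih =>
    by_cases h : IsBlock φ s t X
    · exact ⟨X, Subset.rfl, h⟩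
    · simp only [IsBlock, h2, h4, hX, true_and] at h
      push Not at h
      obtain ⟨Y, hYX, hY2, hY, hne⟩ := h
      have hlt := card_lt_card (hYX.ssubset_of_ne hne)
      obtain ⟨B, hB, hB'⟩ := ih Y.card (hn ▸ hlt) hY hY2 (by omega) rfl
      exact ⟨B, hB.trans hYX, hB'⟩

lemma card_sup_union_add_inter (X Y : Finset E) :
    ((X ∪ Y).sup φ).card + ((X ∩ Y).sup φ).card ≤ (X.sup φ).card + (Y.sup φ).card := by
  rw [← card_union_add_card_inter (X.sup φ), sup_union]
  refine Nat.add_le_add le_rfl (card_le_card (subset_inter ?_ ?_))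
  · exact sup_mono inter_subset_left
  · exact sup_mono inter_subset_right

lemma IsTight.union_inter (hG : NoDense φ s t G) (hX : IsTight φ s t X) (hY : IsTight φ s t Y)
    (hXY : (X ∩ Y).Nonempty) (hc : X.card + Y.card ≤ G) :
    IsTight φ s t (X ∪ Y) ∧ IsTight φ s t (X ∩ Y) := by
  have h1 := card_sup_union_add_inter (φ := φ) X Y
  have h2 := card_union_add_card_inter X Y
  have hU : (X ∪ Y).Nonempty := hXY.mono (inter_subset_left.trans subset_union_left)
  have h3 := hG _ hXY (by omega)
  have h4 := hG _ hU (by omega)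
  have h5 : (X ∪ Y).card * s + (X ∩ Y).card * s = X.card * s + Y.card * s := by
    rw [← add_mul, h2, add_mul]
  have h6 := hX.2
  have h7 := hY.2
  exact ⟨⟨hU, by omega⟩, ⟨hXY, by omega⟩⟩

lemma isTight_singleton (hφ : ∀ e, (φ e).card = s + t) (e : E) : IsTight φ s t {e} :=
  ⟨singleton_nonempty e, by simp [hφ]⟩

lemma IsBlock.inter_eq (hG : NoDense φ s t G) (hB : IsBlock φ s t B) (hX : IsTight φ s t X)
    (hc : X.card + 4 ≤ G) (h2 : 2 ≤ (X ∩ B).card) : B ⊆ X := by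
  have h := (hX.union_inter hG hB.2.2.1 (card_pos.1 (by omega)) (by have := hB.2.1; omega)).2
  have := hB.2.2.2 _ inter_subset_right h2 h
  exact inter_eq_right.1 this

lemma two_le_card_of_mem (he : e ∈ X) (hf : f ∈ X) (hef : e ≠ f) : 2 ≤ X.card :=
  one_lt_card.2 ⟨e, he, f, hf, hef⟩

section Reach

variable [Fintype E]

lemma mem_blocks : B ∈ blocks φ s t ↔ IsBlock φ s t B := by simp [blocks]

lemma exists_tight_of_mem_reach (hφ : ∀ e, (φ e).card = s + t) (hG : NoDense φ s t G) {k : ℕ}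
    (hk : 3 * k + 5 ≤ G) (hfe : f ≠ e) (hf' : f' ∈ reach (blocks φ s t) e k f) :
    ∃ X, IsTight φ s t X ∧ f ∈ X ∧ f' ∈ X ∧ e ∉ X ∧ X.card ≤ 3 * k + 1 := by
  induction k generalizing f with
  | zero =>
    have h : f' = f := hf'
    subst h
    exact ⟨{f'}, isTight_singleton hφ f', by simp, by simp, by simpa using hfe.symm, by simp⟩
  | succ k ih =>
    rcases hf' with h | ⟨B, hB, heB, hfB, f₁, hf₁, h⟩
    · obtain ⟨X, h1, h2, h3, h4, h5⟩ := ih (by omega) hfe h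
      exact ⟨X, h1, h2, h3, h4, by omega⟩
    · rw [mem_blocks] at hB
      obtain ⟨X, h1, h2, h3, h4, h5⟩ := ih (by omega) (by rintro rfl; exact heB hf₁) h
      have hne : (X ∩ B).Nonempty := ⟨f₁, mem_inter.2 ⟨h2, hf₁⟩⟩
      have h6 := hB.2.1
      refine ⟨X ∪ B, (h1.union_inter hG hB.2.2.1 hne (by omega)).1, mem_union_right _ hfB,
        mem_union_left _ h3, by simp [h4, heB], ?_⟩
      have := card_union_add_card_inter X B
      have := hne.card_pos
      omega

lemma exists_tight_of_not_disjoint (hφ : ∀ e, (φ e).card = s + t) (hG : NoDense φ s t G) {T : ℕ}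
    (hT : 6 * T + 6 ≤ G) (hfe : f ≠ e) (hfe' : f' ≠ e)
    (h : ¬ Disjoint (reach (blocks φ s t) e T f) (reach (blocks φ s t) e T f')) :
    ∃ X, IsTight φ s t X ∧ f ∈ X ∧ f' ∈ X ∧ e ∉ X ∧ X.card ≤ 6 * T + 2 := by
  rw [Set.not_disjoint_iff] at h
  obtain ⟨x, hx, hx'⟩ := h
  obtain ⟨X, h1, h2, h3, h4, h5⟩ := exists_tight_of_mem_reach hφ hG (by omega) hfe hx
  obtain ⟨Y, h1', h2', h3', h4', h5'⟩ := exists_tight_of_mem_reach hφ hG (by omega) hfe' hx'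
  refine ⟨X ∪ Y, (h1.union_inter hG h1' ⟨x, mem_inter.2 ⟨h3, h3'⟩⟩ (by omega)).1,
    mem_union_left _ h2, mem_union_right _ h2', by simp [h4, h4'], ?_⟩
  have := card_union_le X Y
  omega

lemma disjoint_reach_of_mem_block (hφ : ∀ e, (φ e).card = s + t) (hG : NoDense φ s t G) {T : ℕ}
    (hT : 6 * T + 10 ≤ G) (hB : IsBlock φ s t B) (he : e ∈ B) (hf : f ∈ B) (hf' : f' ∈ B)
    (hfe : f ≠ e) (hfe' : f' ≠ e) (hff : f ≠ f') :
    Disjoint (reach (blocks φ s t) e T f) (reach (blocks φ s t) e T f') := by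
  by_contra h
  obtain ⟨X, h1, h2, h3, h4, h5⟩ := exists_tight_of_not_disjoint hφ hG (by omega) hfe hfe' h
  exact h4 (hB.inter_eq hG h1 (by omega)
    (two_le_card_of_mem (mem_inter.2 ⟨h2, hf⟩) (mem_inter.2 ⟨h3, hf'⟩) hff) he)

lemma disjoint_reach_of_blocks (hφ : ∀ e, (φ e).card = s + t) (hG : NoDense φ s t G) {T : ℕ}
    (hT : 6 * T + 10 ≤ G) (hB : IsBlock φ s t B) (hB' : IsBlock φ s t B') (hne : B ≠ B')
    (h3 : 3 ≤ B'.card) (he : e ∈ B) (he' : e ∈ B') (hf : f ∈ B) (hf' : f' ∈ B')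
    (hfe : f ≠ e) (hfe' : f' ≠ e) :
    Disjoint (reach (blocks φ s t) e T f) (reach (blocks φ s t) e T f') := by
  by_contra h
  obtain ⟨X, hX, hfX, hfX', heX, hXc⟩ := exists_tight_of_not_disjoint hφ hG (by omega) hfe hfe' h
  have hB4 := hB.2.1
  have hB4' := hB'.2.1
  have hU := (hX.union_inter hG hB.2.2.1 ⟨f, mem_inter.2 ⟨hfX, hf⟩⟩ (by omega)).1
  have hUc := card_union_add_card_inter X B
  have hpos : 0 < (X ∩ B).card := card_pos.2 ⟨f, mem_inter.2 ⟨hfX, hf⟩⟩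
  have hsub : B' ⊆ X ∪ B := hB'.inter_eq hG hU (by omega)
    (two_le_card_of_mem (mem_inter.2 ⟨mem_union_right _ he, he'⟩)
      (mem_inter.2 ⟨mem_union_left _ hfX', hf'⟩) hfe'.symm)
  have hBB : ∀ x ∈ B', x ∈ B → x = e := by
    intro x hx hx'
    by_contra hxe
    have h2 : 2 ≤ (B ∩ B').card :=
      two_le_card_of_mem (mem_inter.2 ⟨hx', hx⟩) (mem_inter.2 ⟨he, he'⟩) hxe
    have h4 := hB'.inter_eq hG hB.2.2.1 (by omega) h2
    rw [inter_comm] at h2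
    exact hne ((hB.inter_eq hG hB'.2.2.1 (by omega) h2).antisymm h4)
  have hsub' : B'.erase e ⊆ X ∩ B' := by
    intro x hx
    rw [mem_erase] at hx
    refine mem_inter.2 ⟨?_, hx.2⟩
    rcases mem_union.1 (hsub hx.2) with h | h
    · exact h
    · exact absurd (hBB x hx.2 h) hx.1
  have hc := card_le_card hsub'
  rw [card_erase_of_mem he'] at hc
  exact heX (hB'.inter_eq hG hX (by omega) (by omega) he')

lemma isBlock_pair (hφ : ∀ e, (φ e).card = s + t) (hef : e ≠ f) {S : Finset α}
    (hS : S ∈ powersetCard t (φ e)) (hS' : S ∈ powersetCard t (φ f)) :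
    IsBlock φ s t {e, f} := by
  rw [mem_powersetCard] at hS hS'
  refine ⟨(card_pair hef).ge, by rw [card_pair hef]; omega, ⟨by simp, ?_⟩, fun Y hY h2 _ => ?_⟩
  · have h1 := card_union_add_card_inter (φ e) (φ f)
    have h2 := card_le_card (subset_inter hS.1 hS'.1)
    rw [card_pair hef, sup_insert, sup_singleton, sup_eq_union]
    rw [hφ, hφ] at h1
    omega
  · exact eq_of_subset_of_card_le hY (by rwa [card_pair hef])

lemma IsBlock.exists_common (hφ : ∀ e, (φ e).card = s + t) (hef : e ≠ f)
    (hB : IsBlock φ s t {e, f}) : ∃ S ∈ powersetCard t (φ e), S ∈ powersetCard t (φ f) := by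
  have h1 := card_union_add_card_inter (φ e) (φ f)
  have h2 := hB.2.2.1.2
  rw [card_pair hef, sup_insert, sup_singleton, sup_eq_union] at h2
  rw [hφ, hφ] at h1
  obtain ⟨S, hS, hSc⟩ := exists_subset_card_eq (s := φ e ∩ φ f) (n := t) (by omega)
  exact ⟨S, mem_powersetCard.2 ⟨hS.trans inter_subset_left, hSc⟩,
    mem_powersetCard.2 ⟨hS.trans inter_subset_right, hSc⟩⟩

lemma disjoint_reach_of_stars (hφ : ∀ e, (φ e).card = s + t) (hG : NoDense φ s t G) {T : ℕ}
    (hT : 6 * T + 10 ≤ G) {S S' : Finset α} (hne : S ≠ S') (hS : S ∈ powersetCard t (φ e))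
    (hS' : S' ∈ powersetCard t (φ e)) (hf : S ∈ powersetCard t (φ f))
    (hf' : S' ∈ powersetCard t (φ f')) (hfe : f ≠ e) (hfe' : f' ≠ e) :
    Disjoint (reach (blocks φ s t) e T f) (reach (blocks φ s t) e T f') := by
  by_contra h
  obtain ⟨X, hX, hfX, hfX', heX, hXc⟩ := exists_tight_of_not_disjoint hφ hG (by omega) hfe hfe' h
  rw [mem_powersetCard] at hS hS' hf hf'
  have h1 := hG (insert e X) (insert_nonempty e X) (by rw [card_insert_of_notMem heX]; omega)
  rw [card_insert_of_notMem heX, sup_insert, sup_eq_union, add_mul] at h1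
  have h2 := card_union_add_card_inter (φ e) (X.sup φ)
  have h3 : S ∪ S' ⊆ φ e ∩ X.sup φ := by
    refine subset_inter (union_subset hS.1 hS'.1) (union_subset ?_ ?_)
    · exact hf.1.trans (le_sup (f := φ) hfX)
    · exact hf'.1.trans (le_sup (f := φ) hfX')
  have h4 : S ⊂ S ∪ S' := by
    refine subset_union_left.ssubset_of_ne fun h => hne ?_
    exact (eq_of_subset_of_card_le (union_eq_left.1 h.symm) (by omega)).symm
  have h5 := card_lt_card h4
  have h6 := card_le_card h3
  have h7 := hX.2
  rw [hφ] at h2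
  omega

open Classical in
lemma locallySparse_blocks {T : ℕ} (hφ : ∀ e, (φ e).card = s + t) (hG : NoDense φ s t G)
    (hT : 6 * T + 10 ≤ G) {D K : ℝ} (hD : 0 < D)
    (hdeg : ∀ S : Finset α, S.card = t →
      ((univ.filter (fun e => S ⊆ φ e)).card : ℝ) ≤ D)
    (hK : ∀ e, ∑ X with IsTight φ s t X ∧ 3 ≤ X.card ∧ X.card ≤ 4 ∧ e ∈ X,
      (D⁻¹) ^ (X.card - 1) ≤ K) :
    LocallySparse (blocks φ s t) (fun e => powersetCard t (φ e)) T ((s + t).choose t) D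
      ((s + t).choose t + K) where
  two_le_card B hB := (mem_blocks.1 hB).1
  card_le_four B hB := (mem_blocks.1 hB).2.1
  card_V e := by rw [card_powersetCard, hφ]
  degree e S hS F hF := by
    refine le_trans ?_ (hdeg S (mem_powersetCard.1 hS).2)
    exact_mod_cast card_le_card fun f hf => by
      simpa using (mem_powersetCard.1 (hF f hf)).1
  pair e f hef hB := (mem_blocks.1 hB).exists_common hφ hef
  weight e := by
    rw [← sum_filter_add_sum_filter_not _ (fun B => B.card = 2)]
    refine add_le_add ?_ (le_trans ?_ (hK e))
    · have h1 : ((blocks φ s t).filter (e ∈ ·)).filter (fun B => B.card = 2) ⊆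
          ((powersetCard t (φ e)).biUnion fun S => univ.filter (fun f => S ⊆ φ f)).image
            (fun f => {e, f}) := by
        intro B hB
        simp only [mem_filter, mem_blocks] at hB
        obtain ⟨⟨hB, heB⟩, h2⟩ := hB
        have h3 : (B.erase e).card = 1 := by rw [card_erase_of_mem heB, h2]
        obtain ⟨f, hf⟩ := card_eq_one.1 h3
        have hBf : B = {e, f} := by rw [← insert_erase heB, hf]
        have hef : e ≠ f := by rintro rfl; simp [hBf] at h2
        obtain ⟨S, hS, hS'⟩ := (hBf ▸ hB).exists_common hφ hef
        refine mem_image.2 ⟨f, mem_biUnion.2 ⟨S, hS, ?_⟩, hBf.symm⟩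
        simpa using (mem_powersetCard.1 hS').1
      have h2 : (((powersetCard t (φ e)).biUnion
          fun S => univ.filter (fun f => S ⊆ φ f)).card : ℝ) ≤ (s + t).choose t * D := by
        calc _ ≤ ((∑ S ∈ powersetCard t (φ e), (univ.filter (fun f => S ⊆ φ f)).card : ℕ) : ℝ) := by
              exact_mod_cast card_biUnion_le
          _ ≤ ∑ S ∈ powersetCard t (φ e), D := by
              push_cast
              exact sum_le_sum fun S hS => hdeg S (mem_powersetCard.1 hS).2
          _ = _ := by rw [sum_const, card_powersetCard, hφ, nsmul_eq_mul]
      have h3 : ((((blocks φ s t).filter (e ∈ ·)).filter (fun B => B.card = 2)).card : ℝ) ≤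
          (s + t).choose t * D := by
        refine le_trans ?_ h2
        exact_mod_cast (card_le_card h1).trans card_image_le
      calc _ = ∑ B ∈ ((blocks φ s t).filter (e ∈ ·)).filter (fun B => B.card = 2), D⁻¹ := by
            refine sum_congr rfl fun B hB => ?_
            rw [(mem_filter.1 hB).2]; simp
        _ ≤ _ := by
            rw [sum_const, nsmul_eq_mul, ← div_eq_mul_inv, div_le_iff₀ hD]
            exact h3
    · refine sum_le_sum_of_subset_of_nonneg (fun B hB => ?_) fun _ _ _ => by positivity
      simp only [mem_filter, mem_blocks, mem_univ, true_and] at hB ⊢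
      have := hB.1.1.1
      exact ⟨hB.1.1.2.2.1, by omega, hB.1.1.2.1, hB.1.2⟩
  disjoint_star e S hS S' hS' hne f hf f' hf' hSf hSf' :=
    disjoint_reach_of_stars hφ hG hT hne hS hS' hSf hSf' hf hf'
  disjoint_star_block e S hS B hB he h3 f hf hSf f' hf' hfe' := by
    refine disjoint_reach_of_blocks hφ hG hT (isBlock_pair hφ hf.symm hS hSf) (mem_blocks.1 hB) ?_
      h3 (by simp) he (by simp) hf' hf hfe'
    rintro rfl
    rw [card_pair hf.symm] at h3
    omega
  disjoint_block e B hB B' hB' he he' _ h3 hne f hf hfe f' hf' hfe' :=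
    disjoint_reach_of_blocks hφ hG hT (mem_blocks.1 hB) (mem_blocks.1 hB') hne h3 he he' hf hf'
      hfe hfe'
  disjoint_mem B hB e he f hf f' hf' hfe hfe' hff :=
    disjoint_reach_of_mem_block hφ hG hT (mem_blocks.1 hB) he hf hf' hfe hfe' hff

end Reach

end Tight

namespace Tight

variable {α : Type*} [Fintype α] [DecidableEq α]

open Classical in
/-- The nonempty families of at most `G` sets violating the condition `NoDense`. -/
noncomputable def denseFamilies (α : Type*) [Fintype α] [DecidableEq α] (s t G : ℕ) :
    Finset (Finset (Finset α)) :=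
  univ.filter fun X => X.Nonempty ∧ X.card ≤ G ∧ (X.sup id).card < X.card * s + t

open Classical in
/-- The tight families of three or four sets. -/
noncomputable def tightFamilies (α : Type*) [Fintype α] [DecidableEq α] (s t : ℕ) :
    Finset (Finset (Finset α)) :=
  univ.filter fun X => IsTight id s t X ∧ 3 ≤ X.card ∧ X.card ≤ 4

/-- The number of sets in `W` containing `S`. -/
def degree (W : Finset (Finset α)) (S : Finset α) : ℕ := (W.filter (S ⊆ ·)).card

/-- A family `H` of sets without dense subfamilies, of bounded degree and with a bounded weight of
tight triples and quadruples through each set. -/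
structure IsRegularized (H : Finset (Finset α)) (s t G : ℕ) (D K : ℝ) : Prop where
  card_eq : ∀ e ∈ H, e.card = s + t
  noDense : ∀ X ∈ denseFamilies α s t G, ¬ X ⊆ H
  degree_le : ∀ S, S.card = t → (degree H S : ℝ) ≤ D
  weight_le : ∀ e ∈ H, ∑ X ∈ tightFamilies α s t with X ⊆ H ∧ e ∈ X, (D⁻¹) ^ (X.card - 1) ≤ K

lemma exists_isRegularized_subset {W : Finset (Finset α)} {s t G : ℕ} {D K γ : ℝ} (hD : 0 < D)
    (hK : 0 < K) (hγ : 0 < γ) (hγ1 : γ ≤ 1) (hW : ∀ e ∈ W, e.card = s + t) :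
    ∃ H : Finset (Finset α), IsRegularized H s t G D K ∧
      (W.card : ℝ) - ∑ X ∈ denseFamilies α s t G with X ⊆ W, (X.card : ℝ)
        - (∑ S ∈ powersetCard t univ, (degree W S - (1 - γ) * D) ^ 2) / (γ ^ 2 * D)
        - (∑ X ∈ tightFamilies α s t with X ⊆ W, X.card * (D⁻¹) ^ (X.card - 1)) / K ≤ H.card := by
  classical
  set 𝒳 := (denseFamilies α s t G).filter (· ⊆ W)
  set 𝒴 := (tightFamilies α s t).filter (· ⊆ W)
  set 𝒮 := (powersetCard t (univ : Finset α)).filter fun S => D < degree W S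
  set B₁ := 𝒳.biUnion id
  set B₂ := 𝒮.biUnion fun S => W.filter (S ⊆ ·)
  set B₃ := W.filter fun e => K < ∑ X ∈ 𝒴 with e ∈ X, (D⁻¹) ^ (X.card - 1)
  have h1 : (B₁.card : ℝ) ≤ ∑ X ∈ 𝒳, (X.card : ℝ) := by
    exact_mod_cast card_biUnion_le
  have h2 : (B₂.card : ℝ) ≤
      (∑ S ∈ powersetCard t univ, ((degree W S : ℝ) - (1 - γ) * D) ^ 2) / (γ ^ 2 * D) := by
    rw [le_div_iff₀ (by positivity)]
    calc (B₂.card : ℝ) * (γ ^ 2 * D) ≤ (∑ S ∈ 𝒮, (degree W S : ℝ)) * (γ ^ 2 * D) := by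
          refine mul_le_mul_of_nonneg_right ?_ (by positivity)
          exact_mod_cast card_biUnion_le
      _ = ∑ S ∈ 𝒮, (degree W S : ℝ) * (γ ^ 2 * D) := by rw [sum_mul]
      _ ≤ ∑ S ∈ 𝒮, ((degree W S : ℝ) - (1 - γ) * D) ^ 2 := by
          refine sum_le_sum fun S hS => ?_
          have hd := (mem_filter.1 hS).2
          set d : ℝ := (degree W S : ℝ)
          have h3 : γ * d ≤ d - (1 - γ) * D := by nlinarith
          have h4 : (γ * d) ^ 2 ≤ (d - (1 - γ) * D) ^ 2 :=
            pow_le_pow_left₀ (by nlinarith) h3 2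
          have h5 : d * (γ ^ 2 * D) ≤ (γ * d) ^ 2 := by
            have : γ ^ 2 * d * D ≤ γ ^ 2 * d * d :=
              mul_le_mul_of_nonneg_left hd.le (mul_nonneg (by positivity) (by linarith))
            linarith
          linarith
      _ ≤ _ := sum_le_sum_of_subset_of_nonneg (filter_subset _ _) fun _ _ _ => by positivity
  have h3 : (B₃.card : ℝ) ≤ (∑ X ∈ 𝒴, X.card * (D⁻¹) ^ (X.card - 1)) / K := by
    rw [le_div_iff₀ hK]
    calc (B₃.card : ℝ) * K = ∑ e ∈ B₃, K := by rw [sum_const, nsmul_eq_mul]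
      _ ≤ ∑ e ∈ B₃, ∑ X ∈ 𝒴 with e ∈ X, (D⁻¹) ^ (X.card - 1) :=
          sum_le_sum fun e he => (mem_filter.1 he).2.le
      _ ≤ ∑ e, ∑ X ∈ 𝒴 with e ∈ X, (D⁻¹) ^ (X.card - 1) :=
          sum_le_sum_of_subset_of_nonneg (subset_univ _) fun _ _ _ =>
            sum_nonneg fun _ _ => by positivity
      _ = ∑ X ∈ 𝒴, X.card * (D⁻¹) ^ (X.card - 1) := by
          simp only [sum_filter]
          rw [sum_comm]
          refine sum_congr rfl fun X _ => ?_
          rw [← sum_filter, filter_mem_eq_inter, univ_inter, sum_const, nsmul_eq_mul]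
  refine ⟨W \ (B₁ ∪ B₂ ∪ B₃), ⟨?_, ?_, ?_, ?_⟩, ?_⟩
  · exact fun e he => hW e (mem_sdiff.1 he).1
  · intro X hX hsub
    have hX' := hX
    simp only [denseFamilies, mem_filter, mem_univ, true_and] at hX'
    obtain ⟨e, he⟩ := hX'.1
    refine (mem_sdiff.1 (hsub he)).2 (mem_union_left _ (mem_union_left _ ?_))
    exact mem_biUnion.2 ⟨X, mem_filter.2 ⟨hX, hsub.trans sdiff_subset⟩, he⟩
  · intro S hS
    by_contra! h
    have hmono : degree (W \ (B₁ ∪ B₂ ∪ B₃)) S ≤ degree W S :=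
      card_le_card (filter_subset_filter _ sdiff_subset)
    have hpos : 0 < degree (W \ (B₁ ∪ B₂ ∪ B₃)) S := by exact_mod_cast hD.trans h
    obtain ⟨e, he⟩ := card_pos.1 hpos
    obtain ⟨he, hSe⟩ := mem_filter.1 he
    refine (mem_sdiff.1 he).2 (mem_union_left _ (mem_union_right _ (mem_biUnion.2 ⟨S, ?_, ?_⟩)))
    · exact mem_filter.2 ⟨mem_powersetCard.2 ⟨subset_univ _, hS⟩,
        h.trans_le (by exact_mod_cast hmono)⟩
    · exact mem_filter.2 ⟨(mem_sdiff.1 he).1, hSe⟩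
  · intro e he
    have h4 : ¬ K < ∑ X ∈ 𝒴 with e ∈ X, (D⁻¹) ^ (X.card - 1) := fun h =>
      (mem_sdiff.1 he).2 (mem_union_right _ (mem_filter.2 ⟨(mem_sdiff.1 he).1, h⟩))
    refine le_trans ?_ (not_lt.1 h4)
    refine sum_le_sum_of_subset_of_nonneg (fun X hX => ?_) fun _ _ _ => by positivity
    simp only [𝒴, mem_filter] at hX ⊢
    exact ⟨⟨hX.1, hX.2.1.trans sdiff_subset⟩, hX.2.2⟩
  · have h4 := le_card_sdiff (B₁ ∪ B₂ ∪ B₃) W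
    have h5 := card_union_le (B₁ ∪ B₂) B₃
    have h6 := card_union_le B₁ B₂
    have h7 : (W.card : ℝ) ≤ (W \ (B₁ ∪ B₂ ∪ B₃)).card + (B₁.card + B₂.card + B₃.card) := by
      norm_cast
      omega
    linarith

end Tight

namespace Bernoulli

variable {ι : Type*} [Fintype ι] [DecidableEq ι]

lemma ex_card_filter (q : ℝ) (A : Finset ι) :
    ex (fun _ => q) (fun ω => ((A.filter (ω · = true)).card : ℝ)) = A.card * q := by
  have h : (fun ω : ι → Bool => ((A.filter (ω · = true)).card : ℝ)) =
      fun ω => ∑ x ∈ A, if ω x = true then 1 else 0 := by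
    ext ω; rw [sum_boole]
  rw [h, ex_sum, sum_congr rfl fun x _ => (?_ : _ = q), sum_const, nsmul_eq_mul]
  refine Eq.trans ?_ (pr_coord (fun _ => q) x)
  rw [pr]
  congr!

lemma ex_card_filter_sub_sq_le (q : ℝ) (A : Finset ι) :
    ex (fun _ => q) (fun ω => (((A.filter (ω · = true)).card : ℝ) - A.card * q) ^ 2) ≤
      A.card * q := by
  classical
  set c : ℝ := A.card * q with hc
  have h : (fun ω : ι → Bool => (((A.filter (ω · = true)).card : ℝ) - c) ^ 2) =
      fun ω => (∑ x ∈ A, ∑ y ∈ A, if ∀ z ∈ ({x, y} : Finset ι), ω z = true then (1 : ℝ) else 0) -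
        (2 * c * ((A.filter (ω · = true)).card : ℝ) - c ^ 2) := by
    ext ω
    have h1 : ∀ x y, (if ∀ z ∈ ({x, y} : Finset ι), ω z = true then (1 : ℝ) else 0) =
        (if ω x = true then 1 else 0) * (if ω y = true then 1 else 0) := by
      intro x y
      by_cases hx : ω x = true <;> by_cases hy : ω y = true <;> simp [hx, hy]
    simp only [h1]
    rw [← sum_mul_sum, sum_boole]
    ring
  rw [h, ex_sub, ex_sub, ex_mul_left, ex_const, ex_card_filter, ex_sum]
  have h2 : ∀ x ∈ A, ex (fun _ => q) (fun ω => ∑ y ∈ A,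
      if ∀ z ∈ ({x, y} : Finset ι), ω z = true then (1 : ℝ) else 0) ≤ q + A.card * q ^ 2 := by
    intro x hx
    rw [ex_sum]
    have h3 : ∀ y ∈ A, ex (fun _ => q) (fun ω =>
        if ∀ z ∈ ({x, y} : Finset ι), ω z = true then (1 : ℝ) else 0) ≤
          (if x = y then q else 0) + q ^ 2 := by
      intro y _
      have h4 := pr_forall_coord (fun _ : ι => q) {x, y}
      rw [prod_const] at h4
      have h5 : ex (fun _ => q) (fun ω =>
        if ∀ z ∈ ({x, y} : Finset ι), ω z = true then (1 : ℝ) else 0) =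
          q ^ ({x, y} : Finset ι).card := by
        rw [← h4, pr]
        congr!
      rw [h5]
      by_cases hxy : x = y
      · subst hxy
        simp; positivity
      · rw [card_pair hxy]; simp [hxy]
    refine (sum_le_sum h3).trans ?_
    rw [sum_add_distrib, sum_ite_eq, if_pos hx, sum_const, nsmul_eq_mul]
  have h6 := sum_le_sum h2
  rw [sum_const, nsmul_eq_mul] at h6
  have h7 : (A.card : ℝ) * (q + A.card * q ^ 2) = c + c ^ 2 := by rw [hc]; ring
  rw [h7] at h6
  rw [← hc]
  nlinarith

end Bernoulli

namespace Tight
open Bernoulli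

lemma card_families_le {n v : ℕ} (hv : v ≤ n) (𝒳 : Finset (Finset (Finset (Fin n))))
    (h : ∀ X ∈ 𝒳, (X.sup id).card ≤ v) : 𝒳.card ≤ 2 ^ (2 ^ v) * n ^ v := by
  have h1 : 𝒳 ⊆ (powersetCard v (univ : Finset (Fin n))).biUnion fun U => U.powerset.powerset := by
    intro X hX
    obtain ⟨U, hU, hUc⟩ := exists_superset_card_eq (h X hX) (by simpa using hv)
    refine mem_biUnion.2 ⟨U, mem_powersetCard.2 ⟨subset_univ _, hUc⟩, mem_powerset.2 ?_⟩
    exact fun e he => mem_powerset.2 ((le_sup (f := id) he).trans hU)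
  calc 𝒳.card ≤ ∑ U ∈ powersetCard v (univ : Finset (Fin n)), U.powerset.powerset.card :=
        (card_le_card h1).trans card_biUnion_le
    _ = ∑ U ∈ powersetCard v (univ : Finset (Fin n)), 2 ^ (2 ^ v) := by
        refine sum_congr rfl fun U hU => ?_
        rw [card_powerset, card_powerset, (mem_powersetCard.1 hU).2]
    _ = n.choose v * 2 ^ (2 ^ v) := by simp
    _ ≤ 2 ^ (2 ^ v) * n ^ v := by
        rw [mul_comm]
        exact Nat.mul_le_mul_left _ (Nat.choose_le_pow n v)

lemma pow_le_mul_choose {n s t : ℕ} (h : 2 * (s + t) ≤ n) :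
    (n : ℝ) ^ s ≤ 2 ^ s * s.factorial * (n - t).choose s := by
  have h1 := Nat.pow_le_choose (α := ℝ) s (n - t)
  rw [div_le_iff₀ (by positivity)] at h1
  have h2 : (n : ℝ) ≤ 2 * ((n - t + 1 - s : ℕ) : ℝ) := by
    norm_cast
    omega
  calc (n : ℝ) ^ s ≤ (2 * ((n - t + 1 - s : ℕ) : ℝ)) ^ s := pow_le_pow_left₀ (by positivity) h2 s
    _ = 2 ^ s * ((n - t + 1 - s : ℕ) : ℝ) ^ s := mul_pow _ _ _
    _ ≤ 2 ^ s * ((n - t).choose s * s.factorial) := mul_le_mul_of_nonneg_left h1 (by positivity)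
    _ = _ := by ring

lemma sum_pow_card_le {n s k j : ℕ} (hn : k * s + j ≤ n) {q a : ℝ} (hq : 0 ≤ q)
    (hqa : n ^ s * q ≤ a) (𝒳 : Finset (Finset (Finset (Fin n))))
    (h : ∀ X ∈ 𝒳, X.card = k ∧ (X.sup id).card ≤ k * s + j) :
    ∑ X ∈ 𝒳, q ^ X.card ≤ 2 ^ (2 ^ (k * s + j)) * a ^ k * n ^ j := by
  have h1 : (𝒳.card : ℝ) ≤ 2 ^ (2 ^ (k * s + j)) * n ^ (k * s + j) := by
    exact_mod_cast card_families_le hn 𝒳 fun X hX => (h X hX).2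
  calc ∑ X ∈ 𝒳, q ^ X.card = 𝒳.card * q ^ k := by
        rw [sum_congr rfl fun X hX => by rw [(h X hX).1], sum_const, nsmul_eq_mul]
    _ ≤ 2 ^ (2 ^ (k * s + j)) * n ^ (k * s + j) * q ^ k :=
        mul_le_mul_of_nonneg_right h1 (by positivity)
    _ = 2 ^ (2 ^ (k * s + j)) * n ^ j * (n ^ s * q) ^ k := by
        rw [pow_add, mul_pow, ← pow_mul, mul_comm s k]; ring
    _ ≤ 2 ^ (2 ^ (k * s + j)) * n ^ j * a ^ k :=
        mul_le_mul_of_nonneg_left (pow_le_pow_left₀ (by positivity) hqa k) (by positivity)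
    _ = _ := by ring

lemma sum_denseFamilies_le {n s t G : ℕ} (ht : 1 ≤ t) (hn : G * s + t ≤ n) {q a : ℝ} (hq : 0 ≤ q)
    (hqa : n ^ s * q ≤ a) :
    ∑ X ∈ denseFamilies (Fin n) s t G, X.card * q ^ X.card ≤
      (∑ k ∈ Icc 1 G, k * 2 ^ (2 ^ (k * s + (t - 1))) * a ^ k) * n ^ (t - 1) := by
  classical
  have hmem : ∀ X ∈ denseFamilies (Fin n) s t G, X.card ∈ Icc 1 G := by
    intro X hX
    simp only [denseFamilies, mem_filter, mem_univ, true_and] at hX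
    exact mem_Icc.2 ⟨hX.1.card_pos, hX.2.1⟩
  rw [← sum_fiberwise_of_maps_to hmem, sum_mul]
  refine sum_le_sum fun k hk => ?_
  rw [mem_Icc] at hk
  have hks : k * s ≤ G * s := Nat.mul_le_mul_right s hk.2
  have h1 := sum_pow_card_le (n := n) (s := s) (k := k) (j := t - 1) (by omega) hq hqa
    ((denseFamilies (Fin n) s t G).filter (·.card = k)) (by
      intro X hX
      simp only [denseFamilies, mem_filter, mem_univ, true_and] at hX
      obtain ⟨⟨-, -, h⟩, rfl⟩ := hX
      exact ⟨rfl, by omega⟩)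
  calc _ = (k : ℝ) * ∑ X ∈ (denseFamilies (Fin n) s t G).filter (·.card = k), q ^ X.card := by
        rw [mul_sum]
        exact sum_congr rfl fun X hX => by rw [(mem_filter.1 hX).2]
    _ ≤ (k : ℝ) * (2 ^ (2 ^ (k * s + (t - 1))) * a ^ k * n ^ (t - 1)) :=
        mul_le_mul_of_nonneg_left h1 (by positivity)
    _ = _ := by ring

lemma sum_tightFamilies_le {n s t : ℕ} (hn : 4 * s + t ≤ n) {q b D : ℝ} (hq : 0 ≤ q) (hD : 0 < D)
    (hqa : n ^ s * q ≤ b * D) :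
    ∑ X ∈ tightFamilies (Fin n) s t, X.card * (D⁻¹) ^ (X.card - 1) * q ^ X.card ≤
      (∑ k ∈ Icc 3 4, k * 2 ^ (2 ^ (k * s + t)) * b ^ k) * D * n ^ t := by
  classical
  have hmem : ∀ X ∈ tightFamilies (Fin n) s t, X.card ∈ Icc 3 4 := by
    intro X hX
    simp only [tightFamilies, mem_filter, mem_univ, true_and] at hX
    exact mem_Icc.2 hX.2
  rw [← sum_fiberwise_of_maps_to hmem, sum_mul, sum_mul]
  refine sum_le_sum fun k hk => ?_
  rw [mem_Icc] at hk
  have hks : k * s ≤ 4 * s := Nat.mul_le_mul_right s hk.2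
  have h1 := sum_pow_card_le (n := n) (s := s) (k := k) (j := t) (by omega) hq hqa
    ((tightFamilies (Fin n) s t).filter (·.card = k)) (by
      intro X hX
      simp only [tightFamilies, mem_filter, mem_univ, true_and] at hX
      obtain ⟨⟨⟨-, h⟩, -⟩, rfl⟩ := hX
      exact ⟨rfl, h⟩)
  have hDk : (D⁻¹) ^ (k - 1) * D ^ k = D := by
    obtain ⟨m, rfl⟩ : ∃ m, k = m + 1 := ⟨k - 1, by omega⟩
    rw [Nat.add_sub_cancel, pow_succ, ← mul_assoc, ← mul_pow, inv_mul_cancel₀ hD.ne', one_pow,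
      one_mul]
  calc _ = (k : ℝ) * (D⁻¹) ^ (k - 1) *
          ∑ X ∈ (tightFamilies (Fin n) s t).filter (·.card = k), q ^ X.card := by
        rw [mul_sum]
        exact sum_congr rfl fun X hX => by rw [(mem_filter.1 hX).2]
    _ ≤ (k : ℝ) * (D⁻¹) ^ (k - 1) * (2 ^ (2 ^ (k * s + t)) * (b * D) ^ k * n ^ t) :=
        mul_le_mul_of_nonneg_left h1 (by positivity)
    _ = (k : ℝ) * 2 ^ (2 ^ (k * s + t)) * b ^ k * ((D⁻¹) ^ (k - 1) * D ^ k) * n ^ t := by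
        rw [mul_pow]; ring
    _ = _ := by rw [hDk]

lemma ex_sum_subset_le {ι : Type*} [Fintype ι] [DecidableEq ι] {q : ℝ} (hq : 0 ≤ q) (hq1 : q ≤ 1)
    (𝒳 : Finset (Finset ι)) {w : Finset ι → ℝ} (hw : ∀ X, 0 ≤ w X) (A : Finset ι) :
    ex (fun _ => q) (fun ω => ∑ X ∈ 𝒳 with X ⊆ A.filter (ω · = true), w X) ≤
      ∑ X ∈ 𝒳, w X * q ^ X.card := by
  classical
  simp only [sum_filter]
  rw [ex_sum]
  refine sum_le_sum fun X _ => ?_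
  rw [← prod_const, ← pr_forall_coord (fun _ => q) X, pr, ← ex_mul_left]
  refine ex_mono (fun _ => hq) (fun _ => hq1) fun ω => ?_
  by_cases h : X ⊆ A.filter (ω · = true)
  · rw [if_pos h, if_pos fun x hx => (mem_filter.1 (h hx)).2, mul_one]
  · rw [if_neg h]
    exact mul_nonneg (hw X) (by split_ifs <;> norm_num)

end Tight

namespace Tight
open Bernoulli

lemma exists_isRegularized_of_prob {n s t G : ℕ} {D K γ q : ℝ} (hD : 0 < D)
    (hK : 0 < K) (hγ : 0 < γ) (hγ1 : γ ≤ 1) (hq : 0 ≤ q) (hq1 : q ≤ 1)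
    (hqD : (n - t).choose s * q = (1 - γ) * D) :
    ∃ H : Finset (Finset (Fin n)), IsRegularized H s t G D K ∧
      n.choose (s + t) * q - ∑ X ∈ denseFamilies (Fin n) s t G, X.card * q ^ X.card
        - (n.choose t * ((1 - γ) * D)) / (γ ^ 2 * D)
        - (∑ X ∈ tightFamilies (Fin n) s t, X.card * (D⁻¹) ^ (X.card - 1) * q ^ X.card) / K
        ≤ H.card := by
  classical
  set A := powersetCard (s + t) (univ : Finset (Fin n)) with hA
  let W : (Finset (Fin n) → Bool) → Finset (Finset (Fin n)) := fun ω => A.filter (ω · = true)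
  obtain ⟨ω, hω⟩ := exists_ex_le (p := fun _ : Finset (Fin n) => q) (fun _ => hq) (fun _ => hq1)
    (fun ω => ((W ω).card : ℝ) - ∑ X ∈ denseFamilies (Fin n) s t G with X ⊆ W ω, (X.card : ℝ)
        - (γ ^ 2 * D)⁻¹ * (∑ S ∈ powersetCard t univ, (degree (W ω) S - (1 - γ) * D) ^ 2)
        - K⁻¹ * (∑ X ∈ tightFamilies (Fin n) s t with X ⊆ W ω, X.card * (D⁻¹) ^ (X.card - 1)))
  obtain ⟨H, hH, hHc⟩ := exists_isRegularized_subset (G := G) (W := W ω) (s := s) (t := t) hD hK hγ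
    hγ1 (fun e he => (mem_powersetCard.1 (mem_filter.1 he).1).2)
  refine ⟨H, hH, le_trans ?_ hHc⟩
  rw [div_eq_inv_mul _ (γ ^ 2 * D), div_eq_inv_mul _ K, div_eq_inv_mul _ (γ ^ 2 * D),
    div_eq_inv_mul _ K]
  refine le_trans ?_ hω
  rw [ex_sub, ex_sub, ex_sub, ex_mul_left, ex_mul_left, ex_card_filter, ex_sum]
  have hAc : A.card = n.choose (s + t) := by simp [hA]
  rw [hAc]
  refine sub_le_sub (sub_le_sub (sub_le_sub le_rfl ?_) ?_) ?_
  · exact ex_sum_subset_le hq hq1 _ (fun _ => by positivity) A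
  · refine mul_le_mul_of_nonneg_left ?_ (by positivity)
    have h1 : ∀ S ∈ powersetCard t (univ : Finset (Fin n)), ex (fun _ => q)
        (fun ω => ((degree (W ω) S : ℝ) - (1 - γ) * D) ^ 2) ≤ (1 - γ) * D := by
      intro S hS
      have hSc := (mem_powersetCard.1 hS).2
      have h2 : ((A.filter (S ⊆ ·)).card : ℝ) = (n - t).choose s := by
        rw [hA, card_filter_powersetCard_subset S univ (s + t) (subset_univ _) (by omega)]
        simp [hSc]
      have h3 := ex_card_filter_sub_sq_le q (A.filter (S ⊆ ·))
      rw [h2, hqD] at h3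
      refine le_trans (le_of_eq ?_) h3
      congr 1
      ext ω
      simp only [degree, W, filter_filter, and_comm]
    refine (sum_le_sum h1).trans (le_of_eq ?_)
    rw [sum_const, nsmul_eq_mul]
    simp
  · refine mul_le_mul_of_nonneg_left ?_ (by positivity)
    exact ex_sum_subset_le hq hq1 _ (fun _ => by positivity) A

lemma exists_isRegularized (s t : ℕ) (hs : 1 ≤ s) (ht : 1 ≤ t) {γ : ℝ} (hγ : 0 < γ) (hγ1 : γ < 1) :
    ∃ K : ℝ, 0 < K ∧ ∃ D₁ : ℝ, ∀ D, D₁ ≤ D → ∀ G : ℕ, ∃ n₀ : ℕ, ∀ n, n₀ ≤ n →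
      ∃ H : Finset (Finset (Fin n)), IsRegularized H s t G D K ∧
        (1 - 4 * γ) * D * n.choose t ≤ (s + t).choose t * H.card := by
  set b : ℝ := 2 ^ s * s.factorial with hb
  have hb0 : 0 < b := by positivity
  set c : ℝ := (((s + t).choose t : ℕ) : ℝ) with hc
  have hc0 : 0 < c := by
    rw [hc]; exact_mod_cast Nat.choose_pos (by omega)
  set d : ℝ := 2 ^ t * t.factorial with hd
  have hd0 : 0 < d := by positivity
  set c₃ : ℝ := ∑ k ∈ Icc (3 : ℕ) 4, (k : ℝ) * 2 ^ (2 ^ (k * s + t)) * b ^ k with hc₃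
  have hc₃0 : 0 < c₃ := by
    refine sum_pos (fun k hk => ?_) ⟨3, by simp⟩
    rw [mem_Icc] at hk
    have : 0 < k := by omega
    positivity
  refine ⟨c₃ * d * c / γ, by positivity, max 1 (c / γ ^ 3), fun D hD G => ?_⟩
  have hD1 : 1 ≤ D := (le_max_left _ _).trans hD
  have hD2 : c / γ ^ 3 ≤ D := (le_max_right _ _).trans hD
  have hD0 : 0 < D := by linarith
  set c₁ : ℝ := ∑ k ∈ Icc (1 : ℕ) G, (k : ℝ) * 2 ^ (2 ^ (k * s + (t - 1))) * (b * D) ^ k with hc₁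
  obtain ⟨n₁, hn₁⟩ := exists_nat_ge (b * D)
  obtain ⟨n₂, hn₂⟩ := exists_nat_ge (c₁ * d * c / (γ * D))
  refine ⟨2 * (s + t) + 4 * s + t + G * s + t + n₁ + n₂, fun n hn => ?_⟩
  have hnst : 2 * (s + t) ≤ n := by omega
  set N : ℝ := (((n - t).choose s : ℕ) : ℝ) with hN
  have hN0 : 0 < N := by
    rw [hN]; exact_mod_cast Nat.choose_pos (by omega)
  have hnN : (n : ℝ) ^ s ≤ b * N := pow_le_mul_choose hnst
  have hnt : (n : ℝ) ^ t ≤ d * n.choose t := by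
    simpa using pow_le_mul_choose (n := n) (s := t) (t := 0) (by omega)
  have hn1 : (1 : ℝ) ≤ n := by
    have : 1 ≤ n := by omega
    exact_mod_cast this
  have hnn₁ : b * D ≤ n := hn₁.trans (by exact_mod_cast (by omega : n₁ ≤ n))
  have hnn₂ : c₁ * d * c / (γ * D) ≤ n := hn₂.trans (by exact_mod_cast (by omega : n₂ ≤ n))
  have hND : D ≤ N := by
    have : b * D ≤ b * N := hnn₁.trans ((le_self_pow₀ hn1 (by omega)).trans hnN)
    exact le_of_mul_le_mul_left this hb0
  set q : ℝ := (1 - γ) * D / N with hq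
  have hq0 : 0 ≤ q := by
    have : 0 ≤ 1 - γ := by linarith
    positivity
  have hNq : N * q = (1 - γ) * D := by rw [hq]; field_simp
  have hDle : (1 - γ) * D ≤ D := by nlinarith
  have hq1 : q ≤ 1 := by
    rw [hq, div_le_one hN0]
    linarith
  have hqa : (n : ℝ) ^ s * q ≤ b * D := by
    calc (n : ℝ) ^ s * q ≤ b * N * q := mul_le_mul_of_nonneg_right hnN hq0
      _ = b * ((1 - γ) * D) := by rw [mul_assoc, hNq]
      _ ≤ b * D := mul_le_mul_of_nonneg_left hDle hb0.le
  obtain ⟨H, hH, hHc⟩ := exists_isRegularized_of_prob (n := n) (s := s) (t := t) (G := G) (q := q)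
    (K := c₃ * d * c / γ) hD0 (by positivity) hγ hγ1.le hq0 hq1 hNq
  refine ⟨H, hH, ?_⟩
  set P : ℝ := ((n.choose t : ℕ) : ℝ) with hP
  have hP0 : 0 ≤ P := by positivity
  have e1 : c * (n.choose (s + t) * q) = (1 - γ) * D * P := by
    have h := Nat.choose_mul (n := n) (k := s + t) (s := t) (by omega)
    rw [Nat.add_sub_cancel] at h
    have h' : (n.choose (s + t) : ℝ) * c = P * N := by rw [hc, hP, hN]; exact_mod_cast h
    calc c * (n.choose (s + t) * q) = (n.choose (s + t) : ℝ) * c * q := by ring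
      _ = P * (N * q) := by rw [h']; ring
      _ = _ := by rw [hNq]; ring
  have e2 : c * ∑ X ∈ denseFamilies (Fin n) s t G, (X.card : ℝ) * q ^ X.card ≤ γ * D * P := by
    have h1 := sum_denseFamilies_le (n := n) (s := s) (t := t) (G := G) ht (by omega) hq0 hqa
    rw [← hc₁] at h1
    rw [div_le_iff₀ (by positivity)] at hnn₂
    have h2 : (n : ℝ) ^ t = n ^ (t - 1) * n := by
      rw [← pow_succ, Nat.sub_add_cancel ht]
    have h3 : d * (c * (c₁ * n ^ (t - 1))) ≤ d * (γ * D * P) := by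
      calc d * (c * (c₁ * (n : ℝ) ^ (t - 1))) = c₁ * d * c * n ^ (t - 1) := by ring
        _ ≤ n * (γ * D) * n ^ (t - 1) := mul_le_mul_of_nonneg_right hnn₂ (by positivity)
        _ = γ * D * n ^ t := by rw [h2]; ring
        _ ≤ γ * D * (d * P) := mul_le_mul_of_nonneg_left hnt (by positivity)
        _ = _ := by ring
    exact (mul_le_mul_of_nonneg_left h1 hc0.le).trans (le_of_mul_le_mul_left h3 hd0)
  have e3 : c * (P * ((1 - γ) * D) / (γ ^ 2 * D)) ≤ γ * D * P := by
    rw [div_le_iff₀ (by positivity)] at hD2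
    rw [← mul_div_assoc, div_le_iff₀ (by positivity)]
    calc c * (P * ((1 - γ) * D)) ≤ c * (P * D) := by gcongr
      _ ≤ (D * γ ^ 3) * (P * D) := by gcongr
      _ = _ := by ring
  have e4 : c * ((∑ X ∈ tightFamilies (Fin n) s t,
      (X.card : ℝ) * (D⁻¹) ^ (X.card - 1) * q ^ X.card) / (c₃ * d * c / γ)) ≤ γ * D * P := by
    have h1 := sum_tightFamilies_le (n := n) (s := s) (t := t) (by omega) hq0 hD0 hqa
    rw [← hc₃] at h1
    rw [← mul_div_assoc, div_le_iff₀ (by positivity)]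
    calc _ ≤ c * (c₃ * D * n ^ t) := mul_le_mul_of_nonneg_left h1 hc0.le
      _ ≤ c * (c₃ * D * (d * P)) := by gcongr
      _ = _ := by field_simp
  have h := mul_le_mul_of_nonneg_left hHc hc0.le
  rw [mul_sub, mul_sub, mul_sub] at h
  linarith

end Tight

namespace Tight
open Nibble

open Classical in
lemma exists_isFree_subset (s t : ℕ) {δ K : ℝ} (hδ : 0 < δ) (hδ1 : δ < 1) (hK : 0 ≤ K) :
    ∃ (G : ℕ) (D₀ : ℝ), ∀ (n : ℕ) (D : ℝ) (H : Finset (Finset (Fin n))), D₀ ≤ D →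
      IsRegularized H s t G D K →
        ∃ M ⊆ H, IsFree M (4 * s + t) 4 ∧ (1 - 2 * δ) * H.card ≤ M.card * D := by
  obtain ⟨T, D₀, h⟩ := exists_block_free hδ hδ1 ((s + t).choose t)
    (K := (s + t).choose t + K) (by positivity)
  refine ⟨6 * T + 10, max D₀ 1, fun n D H hD hH => ?_⟩
  have hD0 : 0 < D := lt_of_lt_of_le one_pos ((le_max_right _ _).trans hD)
  set ι : H ↪ Finset (Fin n) := Function.Embedding.subtype _ with hι
  have hsup : ∀ X : Finset H, (X.map ι).sup id = X.sup (Subtype.val) := by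
    intro X
    rw [sup_map]
    rfl
  have hsub : ∀ X : Finset H, X.map ι ⊆ H := by
    intro X e he
    obtain ⟨f, -, rfl⟩ := mem_map.1 he
    exact f.2
  have hφ : ∀ e : H, (e : Finset (Fin n)).card = s + t := fun e => hH.card_eq e e.2
  have hG : NoDense (Subtype.val : H → Finset (Fin n)) s t (6 * T + 10) := by
    intro X hX hXc
    by_contra! hlt
    refine hH.noDense (X.map ι) ?_ (hsub X)
    simp only [denseFamilies, mem_filter, mem_univ, true_and, hsup, card_map]
    exact ⟨hX.map, hXc, hlt⟩
  have hdeg : ∀ S : Finset (Fin n), S.card = t →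
      ((univ.filter (fun e : H => S ⊆ (e : Finset (Fin n)))).card : ℝ) ≤ D := by
    intro S hS
    refine le_trans ?_ (hH.degree_le S hS)
    have h1 : (univ.filter (fun e : H => S ⊆ (e : Finset (Fin n)))).card ≤ degree H S := by
      rw [degree, ← card_map ι]
      refine card_le_card fun e he => ?_
      obtain ⟨f, hf, rfl⟩ := mem_map.1 he
      exact mem_filter.2 ⟨f.2, (mem_filter.1 hf).2⟩
    exact_mod_cast h1
  have hKe : ∀ e : H, ∑ X with IsTight (Subtype.val : H → Finset (Fin n)) s t X ∧ 3 ≤ X.card ∧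
      X.card ≤ 4 ∧ e ∈ X, (D⁻¹) ^ (X.card - 1) ≤ K := by
    intro e
    refine le_trans ?_ (hH.weight_le e e.2)
    calc _ = ∑ Y ∈ (univ.filter fun X => IsTight (Subtype.val : H → Finset (Fin n)) s t X ∧
            3 ≤ X.card ∧ X.card ≤ 4 ∧ e ∈ X).map (mapEmbedding ι).toEmbedding,
            (D⁻¹) ^ (Y.card - 1) := by
          rw [sum_map]
          exact sum_congr rfl fun X _ => by simp
      _ ≤ _ := by
          refine sum_le_sum_of_subset_of_nonneg (fun Y hY => ?_) fun _ _ _ => by positivity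
          obtain ⟨X, hX, rfl⟩ := mem_map.1 hY
          obtain ⟨hT, h3, h4, he⟩ := (mem_filter.1 hX).2
          rw [RelEmbedding.coe_toEmbedding, mapEmbedding_apply]
          refine mem_filter.2 ⟨mem_filter.2 ⟨mem_univ _, ⟨hT.1.map, ?_⟩, ?_⟩, hsub X,
            mem_map.2 ⟨e, he, rfl⟩⟩
          · rw [hsup, card_map]
            exact hT.2
          · rw [card_map]
            exact ⟨h3, h4⟩
  obtain ⟨M, hM, hMc⟩ := h H (Finset (Fin n)) _ _ D ((le_max_left _ _).trans hD)
    (locallySparse_blocks hφ hG le_rfl hD0 hdeg hKe)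
  refine ⟨M.map ι, hsub M, ?_, ?_⟩
  · rintro ⟨S, hS, hS4, hSs⟩
    obtain ⟨X, hX, rfl⟩ := subset_map_iff.1 hS
    rw [card_map] at hS4
    rw [hsup] at hSs
    have hXt : IsTight (Subtype.val : H → Finset (Fin n)) s t X :=
      ⟨card_pos.1 (by omega), by rw [hS4]; exact hSs⟩
    obtain ⟨B, hB, hB'⟩ := hXt.exists_block (by omega) hS4.le
    exact hM B (mem_blocks.2 hB') (hB.trans hX)
  · rw [card_map]
    simpa using hMc

end Tight

lemma card_le_exNum {r n s k : ℕ} {G : Finset (Finset (Fin n))} (hG : ∀ e ∈ G, e.card = r)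
    (hf : IsFree G s k) : G.card ≤ exNum r n s k := by
  refine le_csSup ⟨Fintype.card (Finset (Fin n)), ?_⟩ ⟨G, hG, hf, rfl⟩
  rintro _ ⟨F, -, -, rfl⟩
  exact card_le_univ F

lemma IsFree.degree_le {n s t : ℕ} {G : Finset (Finset (Fin n))} (hG : ∀ e ∈ G, e.card = s + t)
    (hf : IsFree G (4 * s + t) 4) {S : Finset (Fin n)} (hS : S.card = t) :
    Tight.degree G S ≤ 3 := by
  by_contra! h
  obtain ⟨X, hX, hX4⟩ := exists_subset_card_eq (show 4 ≤ (G.filter (S ⊆ ·)).card from h)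
  refine hf ⟨X, hX.trans (filter_subset _ _), hX4, ?_⟩
  have h1 : X.sup id ⊆ X.biUnion (· \ S) ∪ S := by
    rw [sup_eq_biUnion]
    intro v hv
    obtain ⟨e, he, hve⟩ := mem_biUnion.1 hv
    by_cases hvS : v ∈ S
    · exact mem_union_right _ hvS
    · exact mem_union_left _ (mem_biUnion.2 ⟨e, he, mem_sdiff.2 ⟨hve, hvS⟩⟩)
  have h2 : (X.biUnion (· \ S)).card ≤ X.card * s := by
    refine card_biUnion_le_card_mul _ _ _ fun e he => ?_
    obtain ⟨heG, hSe⟩ := mem_filter.1 (hX he)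
    rw [card_sdiff_of_subset hSe, hG e heG, hS]
    omega
  rw [hX4] at h2
  exact (card_le_card h1).trans ((card_union_le _ _).trans (by omega))

lemma exNum_mul_choose_le (n s t : ℕ) :
    exNum (s + t) n (4 * s + t) 4 * (s + t).choose t ≤ 3 * n.choose t := by
  rw [← Nat.le_div_iff_mul_le (Nat.choose_pos (by omega))]
  refine csSup_le ⟨0, ∅, by simp, ?_, rfl⟩ ?_
  · rintro ⟨S, hS, hS4, -⟩
    rw [subset_empty.1 hS] at hS4
    simp at hS4
  · rintro _ ⟨G, hG, hf, rfl⟩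
    rw [Nat.le_div_iff_mul_le (Nat.choose_pos (by omega))]
    calc G.card * (s + t).choose t
        = ∑ e ∈ G, ((powersetCard t univ).filter (· ⊆ e)).card := by
          rw [sum_congr rfl fun e he => (?_ : _ = (s + t).choose t), sum_const, smul_eq_mul]
          have h : (powersetCard t univ).filter (· ⊆ e) = powersetCard t e := by
            ext S
            simp [mem_powersetCard, and_comm]
          rw [h, card_powersetCard, hG e he]
      _ = ∑ S ∈ powersetCard t univ, Tight.degree G S :=
          sum_card_bipartiteAbove_eq_sum_card_bipartiteBelow
            (fun (e S : Finset (Fin n)) => S ⊆ e)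
      _ ≤ ∑ S ∈ powersetCard t (univ : Finset (Fin n)), 3 :=
          sum_le_sum fun S hS => hf.degree_le hG (mem_powersetCard.1 hS).2
      _ = 3 * n.choose t := by simp [mul_comm]

lemma one_sub_mul_pow_le_choose {n t : ℕ} {γ : ℝ} (ht : 1 ≤ t) (htn : t ≤ n)
    (hn : (t : ℝ) ^ 2 ≤ γ * n) :
    (1 - γ) * (n : ℝ) ^ t ≤ t.factorial * n.choose t := by
  have hn0 : (0 : ℝ) < n := by exact_mod_cast (by omega : 0 < n)
  have htn' : (t : ℝ) ≤ n := by exact_mod_cast htn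
  have h1 := Nat.pow_le_choose (α := ℝ) t n
  rw [div_le_iff₀ (by positivity), Nat.cast_sub (by omega)] at h1
  have h2 := one_add_mul_le_pow (a := -((t : ℝ) / n)) (by
    have : (t : ℝ) / n ≤ 1 := (div_le_one hn0).2 htn'
    linarith) t
  have h3 : (t : ℝ) * (t / n) ≤ γ := by
    rw [← mul_div_assoc, div_le_iff₀ hn0]
    linarith
  calc (1 - γ) * (n : ℝ) ^ t ≤ (1 + -((t : ℝ) / n)) ^ t * (n : ℝ) ^ t :=
        mul_le_mul_of_nonneg_right (by linarith) (by positivity)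
    _ = ((n : ℝ) - t) ^ t := by
        rw [← mul_pow]
        congr 1
        field_simp
        ring
    _ ≤ (((n + 1 : ℕ) : ℝ) - t) ^ t :=
        pow_le_pow_left₀ (by linarith) (by push_cast; linarith) t
    _ ≤ _ := by linarith

lemma eventually_le_exNum {s t : ℕ} (hs : 1 ≤ s) (ht : 1 ≤ t) {γ : ℝ} (hγ : 0 < γ)
    (hγ1 : γ ≤ 1 / 8) :
    ∀ᶠ n : ℕ in atTop, (1 - 7 * γ) * (1 / ((t.factorial : ℝ) * ((s + t).choose t : ℝ))) ≤
      (exNum (s + t) n (4 * s + t) 4 : ℝ) / (n : ℝ) ^ t := by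
  obtain ⟨K, hK, D₁, h1⟩ := Tight.exists_isRegularized s t hs ht hγ (by linarith)
  obtain ⟨G, D₀, h2⟩ := Tight.exists_isFree_subset s t hγ (by linarith) hK.le
  set D := max 1 (max D₀ D₁) with hD
  have hD0 : 0 < D := lt_of_lt_of_le one_pos (le_max_left _ _)
  obtain ⟨n₀, h3⟩ := h1 D ((le_max_right _ _).trans (le_max_right _ _)) G
  obtain ⟨n₁, hn₁⟩ := exists_nat_ge ((t : ℝ) ^ 2 / γ)
  filter_upwards [eventually_ge_atTop (n₀ + n₁ + t)] with n hn
  obtain ⟨H, hH, hHc⟩ := h3 n (by omega)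
  obtain ⟨M, hMH, hM, hMc⟩ := h2 n D H ((le_max_left _ _).trans (le_max_right _ _)) hH
  have hnn : (t : ℝ) ^ 2 ≤ γ * n := by
    have : (t : ℝ) ^ 2 / γ ≤ n := hn₁.trans (by exact_mod_cast (by omega : n₁ ≤ n))
    rw [div_le_iff₀ hγ] at this
    linarith
  have h4 := one_sub_mul_pow_le_choose ht (by omega) hnn
  have h5 : (M.card : ℝ) ≤ exNum (s + t) n (4 * s + t) 4 := by
    exact_mod_cast card_le_exNum (fun e he => hH.card_eq e (hMH he)) hM
  have hn0 : (0 : ℝ) < n := by exact_mod_cast (by omega : 0 < n)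
  set c : ℝ := (((s + t).choose t : ℕ) : ℝ) with hc
  have hc0 : 0 < c := by
    rw [hc]; exact_mod_cast Nat.choose_pos (by omega)
  set P : ℝ := ((n.choose t : ℕ) : ℝ)
  have h6 : (1 - 6 * γ) * P ≤ c * M.card := by
    refine le_of_mul_le_mul_right ?_ hD0
    calc (1 - 6 * γ) * P * D ≤ (1 - 2 * γ) * ((1 - 4 * γ) * D * P) := by
          have : 0 ≤ γ ^ 2 * (P * D) := by positivity
          nlinarith
      _ ≤ (1 - 2 * γ) * (c * H.card) := mul_le_mul_of_nonneg_left hHc (by linarith)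
      _ = c * ((1 - 2 * γ) * H.card) := by ring
      _ ≤ c * (M.card * D) := mul_le_mul_of_nonneg_left hMc hc0.le
      _ = _ := by ring
  rw [mul_one_div, div_le_div_iff₀ (by positivity) (by positivity)]
  calc (1 - 7 * γ) * (n : ℝ) ^ t ≤ (1 - 6 * γ) * ((1 - γ) * (n : ℝ) ^ t) := by
        have : 0 ≤ γ ^ 2 * (n : ℝ) ^ t := by positivity
        nlinarith
    _ ≤ (1 - 6 * γ) * (t.factorial * P) := mul_le_mul_of_nonneg_left h4 (by linarith)
    _ = t.factorial * ((1 - 6 * γ) * P) := by ring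
    _ ≤ t.factorial * (c * M.card) := mul_le_mul_of_nonneg_left h6 (by positivity)
    _ ≤ t.factorial * (c * exNum (s + t) n (4 * s + t) 4) := by gcongr
    _ = _ := by ring

/-- For all `r ≥ 3` and `2 ≤ t ≤ r-1`, the liminf of `n⁻ᵗ f⁽ʳ⁾(n; 4r-3t, 4)` is at least
`1 / (t! C(r,t))`. -/
theorem bes_k_eq_4_lower (r t : ℕ) (hr : 3 ≤ r) (ht : 2 ≤ t) (htr : t ≤ r - 1) :
    1 / ((t.factorial : ℝ) * (r.choose t : ℝ)) ≤
      atTop.liminf (fun n : ℕ => (exNum r n (4 * r - 3 * t) 4 : ℝ) / (n : ℝ) ^ t) := by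
  obtain ⟨s, rfl⟩ : ∃ s, r = s + t := ⟨r - t, by omega⟩
  rw [show 4 * (s + t) - 3 * t = 4 * s + t by omega]
  have hc : (1 : ℝ) ≤ (s + t).choose t := by
    exact_mod_cast Nat.choose_pos (show t ≤ s + t by omega)
  have hub : ∀ n : ℕ, (exNum (s + t) n (4 * s + t) 4 : ℝ) / (n : ℝ) ^ t ≤ 3 := by
    intro n
    refine div_le_of_le_mul₀ (by positivity) (by norm_num) ?_
    have h1 : (exNum (s + t) n (4 * s + t) 4 : ℝ) * (s + t).choose t ≤ 3 * n.choose t := by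
      exact_mod_cast exNum_mul_choose_le n s t
    have h2 : (n.choose t : ℝ) ≤ (n : ℝ) ^ t := by exact_mod_cast Nat.choose_le_pow n t
    have h3 : (exNum (s + t) n (4 * s + t) 4 : ℝ) ≤
        exNum (s + t) n (4 * s + t) 4 * (s + t).choose t :=
      le_mul_of_one_le_right (by positivity) hc
    linarith
  set L : ℝ := 1 / ((t.factorial : ℝ) * ((s + t).choose t : ℝ)) with hL
  have hL0 : 0 < L := by positivity
  refine le_of_forall_lt_imp_le_of_dense fun a ha => ?_
  refine le_liminf_of_le (isCoboundedUnder_ge_of_le atTop hub) ?_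
  set γ : ℝ := min (1 / 8) ((L - a) / (7 * L)) with hγ
  have hγ0 : 0 < γ := lt_min (by norm_num) (div_pos (by linarith) (by positivity))
  filter_upwards [eventually_le_exNum (s := s) (t := t) (by omega) (by omega) hγ0 (min_le_left _ _)]
    with n hn
  refine le_trans ?_ hn
  rw [← hL]
  have h := min_le_right (1 / 8) ((L - a) / (7 * L))
  rw [← hγ, le_div_iff₀ (by positivity)] at h
  linarith
end

section
/- For all integers k ≥ 2 and r ≥ 3, the limit of n^{-1} f^{(r)}(n; k(r−1)+1, k) as n tends to infinity exists and equals (k−1) / ((k−1)(r−1) + 1). -/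
open Finset Filter

/-- A uniform hypergraph all of whose small edge sets are at least as spread out as hypertrees, and
which has no connected set of `t + 1` edges, is at most as dense as a disjoint union of hypertrees
with `K` edges each, for every `K ≥ t`. -/
theorem card_mul_le_of_sparse {V : Type*} [DecidableEq V] {q t K : ℕ} (htK : t ≤ K)
    (H : Finset (Finset V)) (hu : ∀ e ∈ H, e.card = q + 1)
    (hsmall : ∀ T ⊆ H, T.Nonempty → T.card ≤ t → T.card * q + 1 ≤ (T.sup id).card)
    (hlarge : ∀ T ⊆ H, T.card = t + 1 → (t + 1) * q + 2 ≤ (T.sup id).card) :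
    H.card * (K * q + 1) ≤ K * (H.sup id).card := by
  induction H using Finset.strongInduction with
  | H H ih =>
  rcases H.eq_empty_or_nonempty with rfl | ⟨e₀, he₀⟩
  · simp
  let F := H.powerset.filter
    fun T => T.Nonempty ∧ T.card ≤ t + 1 ∧ (T.sup id).card ≤ T.card * q + 1
  have hF : F.Nonempty := by
    refine ⟨{e₀}, ?_⟩
    simp [F, he₀, hu e₀ he₀]
  obtain ⟨T, hTF, hmax⟩ := F.exists_max_image Finset.card hF
  obtain ⟨hTH, hTne, hTt, hTtight⟩ : T ⊆ H ∧ T.Nonempty ∧ T.card ≤ t + 1 ∧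
      (T.sup id).card ≤ T.card * q + 1 := by simpa [F] using hTF
  have hTt' : T.card ≤ t := by
    by_contra hc
    have h1 : T.card = t + 1 := by omega
    have h2 := hlarge T hTH h1
    rw [h1] at hTtight
    omega
  have hdisj : Disjoint (T.sup id) ((H \ T).sup id) := by
    rw [Finset.disjoint_sup_right]
    intro e he
    by_contra hne
    obtain ⟨heH, heT⟩ := Finset.mem_sdiff.1 he
    have hcard : (insert e T).card = T.card + 1 := Finset.card_insert_of_notMem heT
    have hinter : 0 < (e ∩ T.sup id).card := by
      rw [Finset.card_pos, ← Finset.not_disjoint_iff_nonempty_inter]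
      exact fun h => hne h.symm
    have hunion := Finset.card_union_add_card_inter e (T.sup id)
    rw [hu e heH] at hunion
    have hmem : insert e T ∈ F := by
      simp only [F, Finset.mem_filter, Finset.mem_powerset]
      refine ⟨Finset.insert_subset heH hTH, Finset.insert_nonempty _ _, by omega, ?_⟩
      rw [hcard, Finset.sup_insert, add_mul]
      simp only [id, Finset.sup_eq_union] at hunion ⊢
      change (e ∪ T.sup id).card + (e ∩ T.sup id).card = _ + (T.sup id).card at hunion
      omega
    have := hmax _ hmem
    omega
  have hsub : H \ T ⊆ H := Finset.sdiff_subset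
  have hrest := ih (H \ T) (Finset.sdiff_ssubset hTH hTne) (fun e he => hu e (hsub he))
    (fun S hS => hsmall S (hS.trans hsub)) (fun S hS => hlarge S (hS.trans hsub))
  have hsup : (H.sup id).card = (T.sup id).card + ((H \ T).sup id).card := by
    rw [← Finset.card_union_of_disjoint hdisj, ← Finset.sup_eq_union, ← Finset.sup_union,
      Finset.union_sdiff_of_subset hTH]
  have hcardH : H.card = T.card + (H \ T).card := by
    have := Finset.card_sdiff_add_card_eq_card hTH
    omega
  have hT := hsmall T hTH hTne hTt'
  rw [hsup, hcardH]
  nlinarith [Nat.mul_le_mul_left K hT, hTt'.trans htK]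

/-- Upper bound on the size of a `(q+1)`-uniform hypergraph without `K + 1` edges spanning at most
`(K + 1) * q + 1` vertices. -/
theorem IsFree.card_mul_le {V : Type*} [DecidableEq V] [Fintype V] {q K : ℕ}
    {G : Finset (Finset V)} (hu : ∀ e ∈ G, e.card = q + 1)
    (hG : IsFree G ((K + 1) * q + 1) (K + 1)) :
    G.card * (K * q + 1) ≤ K * Fintype.card V + K * (K * q + 1) := by
  let F := G.powerset.filter fun S => S.card ≤ K ∧ (S.sup id).card ≤ S.card * q
  have hF : F.Nonempty := ⟨∅, by simp [F]⟩
  obtain ⟨S, hSF, hmax⟩ := F.exists_max_image Finset.card hF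
  obtain ⟨hSG, hSK, hSq⟩ : S ⊆ G ∧ S.card ≤ K ∧ (S.sup id).card ≤ S.card * q := by
    simpa [F] using hSF
  have hunion : ∀ T ⊆ G \ S, (S ∪ T).card = S.card + T.card ∧
      ((S ∪ T).sup id).card ≤ S.card * q + (T.sup id).card := by
    intro T hT
    constructor
    · exact Finset.card_union_of_disjoint
        (Finset.disjoint_of_subset_right hT Finset.disjoint_sdiff)
    · rw [Finset.sup_union]
      exact (Finset.card_union_le _ _).trans (by omega)
  have hsubG : ∀ T ⊆ G \ S, S ∪ T ⊆ G := fun T hT =>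
    Finset.union_subset hSG (hT.trans Finset.sdiff_subset)
  have key := card_mul_le_of_sparse (q := q) (t := K - S.card) (K := K) (by omega) (G \ S)
    (fun e he => hu e (Finset.sdiff_subset he))
    (by
      intro T hT hne hTt
      by_contra hc
      obtain ⟨h1, h2⟩ := hunion T hT
      have hpos := hne.card_pos
      have := hmax (S ∪ T) (by
        simp only [F, Finset.mem_filter, Finset.mem_powerset]
        refine ⟨hsubG T hT, by omega, ?_⟩
        rw [h1, add_mul]
        omega)
      omega)
    (by
      intro T hT hTt
      by_contra hc
      obtain ⟨h1, h2⟩ := hunion T hT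
      refine hG ⟨S ∪ T, hsubG T hT, by omega, ?_⟩
      have h3 : (K + 1) * q = S.card * q + (K - S.card + 1) * q := by
        rw [← add_mul]
        congr 1
        omega
      omega)
  have hcard : G.card = S.card + (G \ S).card := by
    have := Finset.card_sdiff_add_card_eq_card hSG
    omega
  have hV := Nat.mul_le_mul_left K (Finset.card_le_univ ((G \ S).sup id))
  rw [hcard, add_mul]
  have := Nat.mul_le_mul_right (K * q + 1) hSK
  omega

/-- Disjoint unions of `m` stars with `K` edges of size `q + 1` each contain no `K + 1` edges
spanning at most `(K + 1) * q + 1` vertices. -/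
theorem exists_isFree_card_eq {n m q K : ℕ} (hq : 1 ≤ q) (hm : m * (K * q + 1) ≤ n) :
    ∃ G : Finset (Finset (Fin n)), (∀ e ∈ G, e.card = q + 1) ∧
      IsFree G ((K + 1) * q + 1) (K + 1) ∧ G.card = m * K := by
  obtain ⟨φ⟩ : Nonempty (Fin m × Option (Fin K × Fin q) ↪ Fin n) :=
    Function.Embedding.nonempty_of_card_le (by simpa using hm)
  let edge : Fin m × Fin K → Finset (Fin n) := fun p =>
    Finset.univ.image fun x : Option (Fin q) => φ (p.1, x.map fun y => (p.2, y))
  have hedge : Function.Injective edge := by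
    intro p p' h
    have hmem : φ (p.1, some (p.2, ⟨0, hq⟩)) ∈ edge p' := by
      rw [← h]
      exact Finset.mem_image.2 ⟨some ⟨0, hq⟩, Finset.mem_univ _, rfl⟩
    obtain ⟨x, -, hx⟩ := Finset.mem_image.1 hmem
    have hx := φ.injective hx
    cases x with
    | none => simp at hx
    | some y =>
      simp only [Option.map_some, Prod.mk.injEq, Option.some.injEq] at hx
      exact Prod.ext hx.1.symm hx.2.1.symm
  refine ⟨Finset.univ.image edge, ?_, ?_, ?_⟩
  · intro e he
    obtain ⟨p, -, rfl⟩ := Finset.mem_image.1 he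
    rw [Finset.card_image_of_injective]
    · simp
    · intro x y hxy
      have := φ.injective hxy
      simp only [Prod.mk.injEq, true_and] at this
      exact Option.map_injective (fun a b hab => (Prod.ext_iff.1 hab).2) this
  · rintro ⟨S, hS, hcard, hspan⟩
    obtain ⟨P, -, rfl⟩ := Finset.subset_image_iff.1 hS
    rw [Finset.card_image_of_injective _ hedge] at hcard
    let leaves : Finset (Fin n) := (P ×ˢ (Finset.univ : Finset (Fin q))).image
      fun x => φ (x.1.1, some (x.1.2, x.2))
    let centres : Finset (Fin n) := (P.image Prod.fst).image fun i => φ (i, none)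
    have hleaves : leaves.card = (K + 1) * q := by
      rw [Finset.card_image_of_injective, Finset.card_product, hcard, Finset.card_univ,
        Fintype.card_fin]
      rintro ⟨⟨a, b⟩, c⟩ ⟨⟨a', b'⟩, c'⟩ h
      have := φ.injective h
      simp_all
    have hcentres : 2 ≤ centres.card := by
      rw [Finset.card_image_of_injective]
      · by_contra hc
        have hfib := Finset.card_le_mul_card_image (f := Prod.fst) P K (by
          intro i _
          calc (P.filter fun p => p.1 = i).card ≤ (Finset.univ : Finset (Fin K)).card := by
                refine Finset.card_le_card_of_injOn Prod.snd (fun _ _ => Finset.mem_coe.2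
                  (Finset.mem_univ _)) ?_
                intro a ha b hb hab
                simp only [Finset.coe_filter, Set.mem_ofPred_eq] at ha hb
                exact Prod.ext (ha.2.trans hb.2.symm) hab
            _ = K := by simp)
        have : K * (P.image Prod.fst).card ≤ K * 1 := Nat.mul_le_mul_left K (by omega)
        omega
      · intro i j h
        have := φ.injective h
        simpa using this
    have hdisj : Disjoint leaves centres := by
      rw [Finset.disjoint_left]
      intro v hv hv'
      obtain ⟨x, -, rfl⟩ := Finset.mem_image.1 hv
      obtain ⟨i, -, hi⟩ := Finset.mem_image.1 hv'
      have := φ.injective hi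
      simp at this
    have hsub : leaves ∪ centres ⊆ (P.image edge).sup id := by
      intro v hv
      rw [Finset.mem_sup]
      rcases Finset.mem_union.1 hv with hv | hv
      · obtain ⟨x, hx, rfl⟩ := Finset.mem_image.1 hv
        exact ⟨edge x.1, Finset.mem_image_of_mem _ (Finset.mem_product.1 hx).1,
          Finset.mem_image.2 ⟨some x.2, Finset.mem_univ _, rfl⟩⟩
      · obtain ⟨i, hi, rfl⟩ := Finset.mem_image.1 hv
        obtain ⟨p, hp, rfl⟩ := Finset.mem_image.1 hi
        exact ⟨edge p, Finset.mem_image_of_mem _ hp,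
          Finset.mem_image.2 ⟨none, Finset.mem_univ _, rfl⟩⟩
    have := Finset.card_le_card hsub
    rw [Finset.card_union_of_disjoint hdisj] at this
    omega
  · rw [Finset.card_image_of_injective _ hedge]
    simp

theorem exNum_set_bddAbove (r n s k : ℕ) :
    BddAbove {m : ℕ | ∃ G : Finset (Finset (Fin n)),
      (∀ e ∈ G, e.card = r) ∧ IsFree G s k ∧ G.card = m} := by
  refine ⟨Fintype.card (Finset (Fin n)), ?_⟩
  rintro m ⟨G, -, -, rfl⟩
  exact Finset.card_le_univ G

theorem exNum_mul_le (n q K : ℕ) :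
    exNum (q + 1) n ((K + 1) * q + 1) (K + 1) * (K * q + 1) ≤ K * n + K * (K * q + 1) := by
  rcases Set.eq_empty_or_nonempty {m : ℕ | ∃ G : Finset (Finset (Fin n)),
    (∀ e ∈ G, e.card = q + 1) ∧ IsFree G ((K + 1) * q + 1) (K + 1) ∧ G.card = m} with h | h
  · simp [exNum, h]
  · obtain ⟨G, hu, hG, hcard⟩ := Nat.sSup_mem h (exNum_set_bddAbove _ _ _ _)
    rw [exNum, ← hcard]
    simpa using hG.card_mul_le hu

theorem div_mul_le_exNum {q : ℕ} (hq : 1 ≤ q) (n K : ℕ) :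
    n / (K * q + 1) * K ≤ exNum (q + 1) n ((K + 1) * q + 1) (K + 1) :=
  le_csSup (exNum_set_bddAbove _ _ _ _) (exists_isFree_card_eq hq (Nat.div_mul_le_self _ _))

/-- For all `k ≥ 2` and `r ≥ 3`, the limit of `n⁻¹ f⁽ʳ⁾(n; k(r-1)+1, k)` exists and equals
`(k-1) / ((k-1)(r-1) + 1)`. -/
theorem bes_t_eq_1 (k r : ℕ) (hk : 2 ≤ k) (hr : 3 ≤ r) :
    Tendsto (fun n : ℕ => (exNum r n (k * (r - 1) + 1) k : ℝ) / (n : ℝ)) atTop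
      (nhds (((k : ℝ) - 1) / (((k : ℝ) - 1) * ((r : ℝ) - 1) + 1))) := by
  obtain ⟨K, rfl⟩ : ∃ K, k = K + 1 := ⟨k - 1, by omega⟩
  obtain ⟨q, rfl⟩ : ∃ q, r = q + 1 := ⟨r - 1, by omega⟩
  simp only [Nat.add_sub_cancel, Nat.cast_add, Nat.cast_one, add_sub_cancel_right]
  have hD : (0 : ℝ) < K * q + 1 := by positivity
  have hzero : Tendsto (fun n : ℕ => (K : ℝ) / (n : ℝ)) atTop (nhds 0) :=
    tendsto_const_div_atTop_nhds_zero_nat _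
  have hlow : Tendsto (fun n : ℕ => (K : ℝ) / (K * q + 1) - K / n) atTop
      (nhds ((K : ℝ) / (K * q + 1))) := by
    simpa using tendsto_const_nhds.sub hzero
  have hupp : Tendsto (fun n : ℕ => (K : ℝ) / (K * q + 1) + K / n) atTop
      (nhds ((K : ℝ) / (K * q + 1))) := by
    simpa using tendsto_const_nhds.add hzero
  refine tendsto_of_tendsto_of_tendsto_of_le_of_le' hlow hupp ?_ ?_
  · filter_upwards [eventually_gt_atTop 0] with n hn
    have hn' : (0 : ℝ) < n := by exact_mod_cast hn
    have hdiv : (n : ℝ) ≤ ((n / (K * q + 1) : ℕ) + 1 : ℝ) * (K * q + 1) := by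
      have := (Nat.lt_div_mul_add (a := n) (b := K * q + 1) (by omega)).le
      rw [← Nat.succ_mul] at this
      exact_mod_cast this
    have hex : ((n / (K * q + 1) : ℕ) : ℝ) * K ≤
        exNum (q + 1) n ((K + 1) * q + 1) (K + 1) := by
      exact_mod_cast div_mul_le_exNum (by omega) n K
    rw [le_div_iff₀ hn', sub_mul, div_mul_cancel₀ _ hn'.ne', div_mul_eq_mul_div,
      sub_le_iff_le_add, div_le_iff₀ hD]
    have hK : (0 : ℝ) ≤ K := by positivity
    nlinarith [mul_le_mul_of_nonneg_left hdiv hK, mul_le_mul_of_nonneg_right hex hD.le]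
  · filter_upwards [eventually_gt_atTop 0] with n hn
    have hn' : (0 : ℝ) < n := by exact_mod_cast hn
    have hex : (exNum (q + 1) n ((K + 1) * q + 1) (K + 1) : ℝ) * (K * q + 1) ≤
        K * n + K * (K * q + 1) := by
      exact_mod_cast exNum_mul_le n q K
    rw [div_le_iff₀ hn', add_mul ((K : ℝ) / _), div_mul_cancel₀ _ hn'.ne', div_mul_eq_mul_div,
      div_add' _ _ _ hD.ne', le_div_iff₀ hD]
    exact hex
end

section
/- Let r ≥ 3 and t be integers with 2 ≤ t ≤ r−1, and let G be a (4r−3t, 4)-free r-graph. If {e₁, e₂, e₃} is a set of three distinct edges of G spanning at most 3r−2t−1 vertices (i.e., a (3r−2t−1, 3)-configuration), then every edge e of G other than e₁, e₂, e₃ satisfies |e ∩ (e₁ ∪ e₂ ∪ e₃)| ≤ t−2. -/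
open Finset Filter

/-- In a `(4r-3t, 4)`-free `r`-graph, any edge outside a `(3r-2t-1, 3)`-configuration meets
its vertex set in at most `t-2` vertices. -/
theorem meets_dense_triple_in_few_vertices {V : Type*} [DecidableEq V]
    (r t : ℕ) (hr : 3 ≤ r) (ht : 2 ≤ t) (htr : t ≤ r - 1)
    (G : Finset (Finset V)) (hG : ∀ e ∈ G, e.card = r)
    (hfree : IsFree G (4 * r - 3 * t) 4)
    (e₁ e₂ e₃ : Finset V) (h1 : e₁ ∈ G) (h2 : e₂ ∈ G) (h3 : e₃ ∈ G)
    (h12 : e₁ ≠ e₂) (h13 : e₁ ≠ e₃) (h23 : e₂ ≠ e₃)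
    (hconf : (e₁ ∪ e₂ ∪ e₃).card ≤ 3 * r - 2 * t - 1)
    (e : Finset V) (he : e ∈ G) (he1 : e ≠ e₁) (he2 : e ≠ e₂) (he3 : e ≠ e₃) :
    (e ∩ (e₁ ∪ e₂ ∪ e₃)).card ≤ t - 2 := by
  by_contra! h
  refine hfree ⟨{e, e₁, e₂, e₃}, by simp [insert_subset_iff, *], ?_, ?_⟩
  · rw [card_insert_of_notMem (by simp [*]), card_insert_of_notMem (by simp [*]),
      card_pair h23]
  · have hsup : ({e, e₁, e₂, e₃} : Finset (Finset V)).sup id = e ∪ (e₁ ∪ e₂ ∪ e₃) := by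
      simp [sup_insert, union_assoc]
    have hcard := card_union_add_card_inter e (e₁ ∪ e₂ ∪ e₃)
    have hecard := hG e he
    rw [hsup]
    omega
end
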